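/- For every T > 0, M ≥ 1, ε ∈ (0,1] and every real n ≥ 8, there exists a constant C > 0, depending only on M, ε, T and n, such that every smooth solution (v,u,θ,q) of the radiation hydrodynamics system on [0,T] with (M,ε)-bounded initial data satisfies ‖v_x(t,·)‖ ≤ C(1 + 𝔜(t)^{𝔗₁(n,β)/2}) for all t ∈ [0,T]. -/

import Mathlib

open MeasureTheory Real Set

noncomputable section

namespace RadHydro

/-- Integral over one period `[-1/2, 1/2]` of the torus `𝕋 ≅ ℝ/ℤ`. -/
def tInt (f : ℝ → ℝ) : ℝ := ∫ x in (-(1/2) : ℝ)..(1/2 : ℝ), f x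

/-- Squared `L²` norm over the torus. -/
def L2sq (f : ℝ → ℝ) : ℝ := tInt fun x => (f x) ^ 2

/-- `L^∞` norm over the torus. -/
def Linf (f : ℝ → ℝ) : ℝ := sSup ((fun x => |f x|) '' Icc (-(1/2) : ℝ) (1/2))

/-- Squared `H¹` norm over the torus. -/
def H1sq (f : ℝ → ℝ) : ℝ := L2sq f + L2sq (deriv f)

/-- Squared `H²` norm over the torus. -/
def H2sq (f : ℝ → ℝ) : ℝ := L2sq f + L2sq (deriv f) + L2sq (deriv (deriv f))

/-- Partial derivative in the time variable. -/
def pt (f : ℝ → ℝ → ℝ) (t x : ℝ) : ℝ := deriv (fun s => f s x) t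

/-- Partial derivative in the space variable. -/
def px (f : ℝ → ℝ → ℝ) (t x : ℝ) : ℝ := deriv (f t) x

/-- The heat conductivity `κ(v, θ) = κ₁ + κ₂ v θ^β`. -/
def kappa (κ₁ κ₂ β v θ : ℝ) : ℝ := κ₁ + κ₂ * v * θ ^ β

/-- A smooth solution of the radiation hydrodynamics system (in Lagrangian
coordinates) on `[0, T]`: four `C^∞` functions on `[0,T] × ℝ` (modelled as smooth
functions on all of `ℝ × ℝ`), `1`-periodic in the space variable, with `v > 0`,
`θ > 0`, satisfying the four equations pointwise for `t ∈ [0, T]`, and with the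
normalization `∫_𝕋 v(0, x) dx = 1`. -/
structure Sol (μ R a b κ₁ κ₂ β γ T : ℝ) where
  v : ℝ → ℝ → ℝ
  u : ℝ → ℝ → ℝ
  θ : ℝ → ℝ → ℝ
  q : ℝ → ℝ → ℝ
  smooth_v : ContDiff ℝ (⊤ : ℕ∞) fun p : ℝ × ℝ => v p.1 p.2
  smooth_u : ContDiff ℝ (⊤ : ℕ∞) fun p : ℝ × ℝ => u p.1 p.2
  smooth_θ : ContDiff ℝ (⊤ : ℕ∞) fun p : ℝ × ℝ => θ p.1 p.2
  smooth_q : ContDiff ℝ (⊤ : ℕ∞) fun p : ℝ × ℝ => q p.1 p.2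
  periodic_v : ∀ t, Function.Periodic (v t) 1
  periodic_u : ∀ t, Function.Periodic (u t) 1
  periodic_θ : ∀ t, Function.Periodic (θ t) 1
  periodic_q : ∀ t, Function.Periodic (q t) 1
  v_pos : ∀ t x, 0 < v t x
  θ_pos : ∀ t x, 0 < θ t x
  eq_mass : ∀ t ∈ Icc (0 : ℝ) T, ∀ x : ℝ, pt v t x - px u t x = 0
  eq_mom : ∀ t ∈ Icc (0 : ℝ) T, ∀ x : ℝ,
    pt u t x + px (fun s y => R * θ s y / v s y) t x
      = px (fun s y => μ * px u s y / v s y) t x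
  eq_energy : ∀ t ∈ Icc (0 : ℝ) T, ∀ x : ℝ,
    pt (fun s y => R / (γ - 1) * θ s y + (u s y) ^ 2 / 2) t x
      + px (fun s y => R * θ s y / v s y * u s y) t x + px q t x
      = px (fun s y => μ * u s y * px u s y / v s y) t x
        + px (fun s y => kappa κ₁ κ₂ β (v s y) (θ s y) * px θ s y / v s y) t x
  eq_rad : ∀ t ∈ Icc (0 : ℝ) T, ∀ x : ℝ,
    -px (fun s y => px q s y / v s y) t x + a * v t x * q t x
      + b * px (fun s y => (θ s y) ^ 4) t x = 0
  mean_v : tInt (v 0) = 1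

/-- `(M, ε)`-bounded initial data: `‖(v₀, u₀, θ₀)‖_{H²} ≤ M` and `v₀ ≥ ε`, `θ₀ ≥ ε`. -/
def DataBounded (M ε : ℝ) (v₀ u₀ θ₀ : ℝ → ℝ) : Prop :=
  Real.sqrt (H2sq v₀ + H2sq u₀ + H2sq θ₀) ≤ M ∧ (∀ x, ε ≤ v₀ x) ∧ ∀ x, ε ≤ θ₀ x

variable {μ R a b κ₁ κ₂ β γ T : ℝ}

/-- A solution has `(M, ε)`-bounded initial data. -/
def Sol.Bounded (S : Sol μ R a b κ₁ κ₂ β γ T) (M ε : ℝ) : Prop :=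
  DataBounded M ε (S.v 0) (S.u 0) (S.θ 0)

/-- The auxiliary function `𝔛(t) = ∫₀ᵗ ∫_𝕋 κ(v,θ) θ_t² / v dx ds`. -/
def Sol.X (S : Sol μ R a b κ₁ κ₂ β γ T) (t : ℝ) : ℝ :=
  ∫ s in (0 : ℝ)..t, tInt fun x =>
    kappa κ₁ κ₂ β (S.v s x) (S.θ s x) * (pt S.θ s x) ^ 2 / S.v s x

/-- The auxiliary function `𝔜(t) = max_{0 ≤ s ≤ t} ∫_𝕋 κ(v,θ)² θ_x² / v² dx`. -/
def Sol.Y (S : Sol μ R a b κ₁ κ₂ β γ T) (t : ℝ) : ℝ :=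
  sSup ((fun s => tInt fun x =>
    (kappa κ₁ κ₂ β (S.v s x) (S.θ s x)) ^ 2 * (px S.θ s x) ^ 2 / (S.v s x) ^ 2) ''
      Icc (0 : ℝ) t)

/-- The auxiliary function `ℨ(t) = max_{0 ≤ s ≤ t} ∫_𝕋 u_{xx}² / v² dx`. -/
def Sol.Z (S : Sol μ R a b κ₁ κ₂ β γ T) (t : ℝ) : ℝ :=
  sSup ((fun s => tInt fun x => (px (px S.u) s x) ^ 2 / (S.v s x) ^ 2) '' Icc (0 : ℝ) t)

/-- The exponent `𝔗₀(n, p, β)`. -/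
def T0 (n _p β : ℝ) : ℝ :=
  if n < (β + 3) / 2 then 4 / (n * (2 * β + 3)) else (n - β + 5) / (n * (2 * β + 3))

/-- The exponent `𝔗₁(n, β)`. -/
def T1 (n β : ℝ) : ℝ := max (T0 n 8 β) (1 / (2 * β + 3) + T0 n 1 β)

/-- The exponent `𝔘ʸ₁₁(n, β)`. -/
def Uy11 (n β : ℝ) : ℝ := 2 / (2 * β + 3) + T0 n 1 β

/-- The exponent `𝔘ᶻ₁₁(n, β)`. -/
def Uz11 (n β : ℝ) : ℝ := 3 / 4 * (1 / (1 - T0 n (5/2) β))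

/-- The exponent `𝔘ʸ₂(n, β)`. -/
def Uy2 (n β : ℝ) : ℝ := 2 / (2 * β + 3) + T1 n β

/-- The exponent `𝔘ᶻ₂(n, β)`. -/
def Uz2 (n β : ℝ) : ℝ := 3 / 4 * (1 / (1 - T0 n (3/2) β - T1 n β))

end RadHydro

open RadHydro

namespace RadHydro

/-- Joint smoothness of a function of time and space. -/
def Smooth (f : ℝ → ℝ → ℝ) : Prop := ContDiff ℝ (⊤ : ℕ∞) fun p : ℝ × ℝ => f p.1 p.2

namespace Smooth

variable {f g : ℝ → ℝ → ℝ}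

theorem hasFDerivAt (hf : Smooth f) (p : ℝ × ℝ) :
    HasFDerivAt (fun p : ℝ × ℝ => f p.1 p.2) (fderiv ℝ (fun p : ℝ × ℝ => f p.1 p.2) p) p :=
  (ContDiff.differentiable hf (by simp) p).hasFDerivAt

theorem hasDerivAt_px_aux (hf : Smooth f) (t x : ℝ) :
    HasDerivAt (f t) (fderiv ℝ (fun p : ℝ × ℝ => f p.1 p.2) (t, x) (0, 1)) x :=
  (hf.hasFDerivAt (t, x)).comp_hasDerivAt x ((hasDerivAt_const x t).prodMk (hasDerivAt_id x))

theorem hasDerivAt_pt_aux (hf : Smooth f) (t x : ℝ) :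
    HasDerivAt (fun s => f s x) (fderiv ℝ (fun p : ℝ × ℝ => f p.1 p.2) (t, x) (1, 0)) t :=
  HasFDerivAt.comp_hasDerivAt (l := fun p : ℝ × ℝ => f p.1 p.2) (f := fun s => (s, x)) t
    (hf.hasFDerivAt (t, x)) ((hasDerivAt_id t).prodMk (hasDerivAt_const t x))

theorem px_eq (hf : Smooth f) (t x : ℝ) :
    px f t x = fderiv ℝ (fun p : ℝ × ℝ => f p.1 p.2) (t, x) (0, 1) :=
  (hf.hasDerivAt_px_aux t x).deriv

theorem pt_eq (hf : Smooth f) (t x : ℝ) :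
    pt f t x = fderiv ℝ (fun p : ℝ × ℝ => f p.1 p.2) (t, x) (1, 0) :=
  (hf.hasDerivAt_pt_aux t x).deriv

theorem hasDerivAt_px (hf : Smooth f) (t x : ℝ) : HasDerivAt (f t) (px f t x) x :=
  hf.px_eq t x ▸ hf.hasDerivAt_px_aux t x

theorem hasDerivAt_pt (hf : Smooth f) (t x : ℝ) : HasDerivAt (fun s => f s x) (pt f t x) t :=
  hf.pt_eq t x ▸ hf.hasDerivAt_pt_aux t x

theorem contDiff_fderiv (hf : Smooth f) :
    ContDiff ℝ (⊤ : ℕ∞) (fderiv ℝ (fun p : ℝ × ℝ => f p.1 p.2)) :=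
  ContDiff.fderiv_right hf (by simp)

theorem px (hf : Smooth f) : Smooth (px f) := by
  have : (fun p : ℝ × ℝ => RadHydro.px f p.1 p.2) =
      fun p => fderiv ℝ (fun p : ℝ × ℝ => f p.1 p.2) p (0, 1) := by
    funext p; exact hf.px_eq p.1 p.2
  rw [Smooth, this]
  exact hf.contDiff_fderiv.clm_apply contDiff_const

theorem pt (hf : Smooth f) : Smooth (pt f) := by
  have : (fun p : ℝ × ℝ => RadHydro.pt f p.1 p.2) =
      fun p => fderiv ℝ (fun p : ℝ × ℝ => f p.1 p.2) p (1, 0) := by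
    funext p; exact hf.pt_eq p.1 p.2
  rw [Smooth, this]
  exact hf.contDiff_fderiv.clm_apply contDiff_const

theorem pt_px (hf : Smooth f) (t x : ℝ) :
    RadHydro.pt (RadHydro.px f) t x = RadHydro.px (RadHydro.pt f) t x := by
  have e1 : RadHydro.px f =
      fun t x => fderiv ℝ (fun p : ℝ × ℝ => f p.1 p.2) (t, x) (0, 1) := by
    funext t x; exact hf.px_eq t x
  have e2 : RadHydro.pt f =
      fun t x => fderiv ℝ (fun p : ℝ × ℝ => f p.1 p.2) (t, x) (1, 0) := by
    funext t x; exact hf.pt_eq t x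
  have hd : ∀ w : ℝ × ℝ, HasFDerivAt (fun p => fderiv ℝ (fun p : ℝ × ℝ => f p.1 p.2) p w)
      ((fderiv ℝ (fderiv ℝ (fun p : ℝ × ℝ => f p.1 p.2)) (t, x)).flip w) (t, x) := fun w => by
    simpa using ((hf.contDiff_fderiv.differentiable (by simp) (t, x)).hasFDerivAt).clm_apply
      (hasFDerivAt_const w (t, x))
  rw [hf.px.pt_eq, hf.pt.px_eq, e1, e2, (hd (0, 1)).fderiv, (hd (1, 0)).fderiv]
  exact (ContDiffAt.isSymmSndFDerivAt (ContDiff.contDiffAt hf)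
    (by simpa using WithTop.coe_le_coe.2 (le_top : (2 : ℕ∞) ≤ ⊤))) (1, 0) (0, 1)

theorem continuous (hf : Smooth f) : Continuous fun p : ℝ × ℝ => f p.1 p.2 :=
  ContDiff.continuous hf

theorem continuous_comp {X : Type*} [TopologicalSpace X] (hf : Smooth f) {a b : X → ℝ}
    (ha : Continuous a) (hb : Continuous b) : Continuous fun z => f (a z) (b z) :=
  hf.continuous.comp (ha.prodMk hb)

theorem continuous_px (hf : Smooth f) (t : ℝ) : Continuous (f t) :=
  hf.continuous_comp continuous_const continuous_id

theorem const (c : ℝ) : Smooth fun _ _ => c := contDiff_const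

theorem add (hf : Smooth f) (hg : Smooth g) : Smooth fun t x => f t x + g t x :=
  ContDiff.add hf hg

theorem sub (hf : Smooth f) (hg : Smooth g) : Smooth fun t x => f t x - g t x :=
  ContDiff.sub hf hg

theorem mul (hf : Smooth f) (hg : Smooth g) : Smooth fun t x => f t x * g t x :=
  ContDiff.mul hf hg

theorem pow (hf : Smooth f) (k : ℕ) : Smooth fun t x => f t x ^ k :=
  ContDiff.pow hf k

theorem div (hf : Smooth f) (hg : Smooth g) (h : ∀ t x, 0 < g t x) :
    Smooth fun t x => f t x / g t x :=
  ContDiff.div hf hg fun p => (h p.1 p.2).ne'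

theorem rpow (hf : Smooth f) (h : ∀ t x, 0 < f t x) (r : ℝ) : Smooth fun t x => f t x ^ r :=
  ContDiff.rpow_const_of_ne hf fun p => (h p.1 p.2).ne'

theorem log (hf : Smooth f) (h : ∀ t x, 0 < f t x) : Smooth fun t x => Real.log (f t x) :=
  ContDiff.log hf fun p => (h p.1 p.2).ne'

end Smooth

theorem px_periodic {f : ℝ → ℝ → ℝ} (hf : ∀ t, Function.Periodic (f t) 1) (t : ℝ) :
    Function.Periodic (px f t) 1 := fun x => by
  have : f t = fun y => f t (y + 1) := by funext y; exact (hf t y).symm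
  calc px f t (x + 1) = deriv (fun y => f t (y + 1)) x := by
        rw [deriv_comp_add_const]; rfl
    _ = px f t x := by rw [← this]; rfl

theorem tInt_deriv {g g' : ℝ → ℝ} (hg : ∀ x, HasDerivAt g (g' x) x) (hc : Continuous g')
    (hp : g (1 / 2) = g (-(1 / 2))) : tInt g' = 0 := by
  rw [tInt, intervalIntegral.integral_eq_sub_of_hasDerivAt (fun x _ => hg x)
    (hc.intervalIntegrable _ _), hp, sub_self]

theorem Periodic.half {g : ℝ → ℝ} (hg : Function.Periodic g 1) : g (1 / 2) = g (-(1 / 2)) := by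
  rw [← hg (-(1 / 2))]; norm_num

theorem tInt_px {f : ℝ → ℝ → ℝ} (hf : Smooth f) (t : ℝ) (hp : Function.Periodic (f t) 1) :
    tInt (px f t) = 0 :=
  tInt_deriv (hf.hasDerivAt_px t) (hf.px.continuous_px t) (Periodic.half hp)

theorem hasDerivAt_intervalIntegral {F F' : ℝ → ℝ → ℝ}
    (hF : ∀ t x, HasDerivAt (fun s => F s x) (F' t x) t)
    (hc : Continuous fun p : ℝ × ℝ => F p.1 p.2) (hc' : Continuous fun p : ℝ × ℝ => F' p.1 p.2)
    (a b t : ℝ) :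
    HasDerivAt (fun s => ∫ x in a..b, F s x) (∫ x in a..b, F' t x) t := by
  obtain ⟨C, hC⟩ := (isCompact_Icc.prod isCompact_uIcc).exists_bound_of_continuousOn
    (s := Icc (t - 1) (t + 1) ×ˢ uIcc a b) hc'.continuousOn
  have hs : ∀ s, Continuous (F s) := fun s => hc.comp (continuous_const.prodMk continuous_id)
  have hs' : ∀ s, Continuous (F' s) := fun s => hc'.comp (continuous_const.prodMk continuous_id)
  refine (intervalIntegral.hasDerivAt_integral_of_dominated_loc_of_deriv_le
    (Icc_mem_nhds (by linarith : t - 1 < t) (by linarith : t < t + 1))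
    (.of_forall fun s => (hs s).aestronglyMeasurable) ((hs t).intervalIntegrable _ _)
    (hs' t).aestronglyMeasurable (bound := fun _ => C) (.of_forall fun x hx s hst => ?_)
    intervalIntegrable_const (.of_forall fun x _ s _ => hF s x)).2
  exact hC (s, x) ⟨hst, uIoc_subset_uIcc hx⟩

theorem hasDerivAt_tInt {F F' : ℝ → ℝ → ℝ}
    (hF : ∀ t x, HasDerivAt (fun s => F s x) (F' t x) t)
    (hc : Continuous fun p : ℝ × ℝ => F p.1 p.2) (hc' : Continuous fun p : ℝ × ℝ => F' p.1 p.2)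
    (t : ℝ) : HasDerivAt (fun s => tInt (F s)) (tInt (F' t)) t :=
  hasDerivAt_intervalIntegral hF hc hc' _ _ t

theorem Smooth.hasDerivAt_tInt {F : ℝ → ℝ → ℝ} (hF : Smooth F) (t : ℝ) :
    HasDerivAt (fun s => tInt (F s)) (tInt (RadHydro.pt F t)) t :=
  RadHydro.hasDerivAt_tInt hF.hasDerivAt_pt hF.continuous hF.pt.continuous t

theorem continuous_tInt {F : ℝ → ℝ → ℝ} (hc : Continuous fun p : ℝ × ℝ => F p.1 p.2) :
    Continuous fun t => tInt (F t) :=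
  intervalIntegral.continuous_parametric_intervalIntegral_of_continuous' hc _ _

theorem tInt_mono {f g : ℝ → ℝ} (hf : Continuous f) (hg : Continuous g)
    (h : ∀ x ∈ Icc (-(1 / 2) : ℝ) (1 / 2), f x ≤ g x) : tInt f ≤ tInt g :=
  intervalIntegral.integral_mono_on (by norm_num) (hf.intervalIntegrable _ _)
    (hg.intervalIntegrable _ _) h

theorem tInt_congr {f g : ℝ → ℝ} (h : ∀ x, f x = g x) : tInt f = tInt g := by
  rw [funext h]

theorem tInt_const (c : ℝ) : tInt (fun _ => c) = c := by
  simp only [tInt, intervalIntegral.integral_const, smul_eq_mul]; norm_num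

theorem tInt_add {f g : ℝ → ℝ} (hf : Continuous f) (hg : Continuous g) :
    tInt (fun x => f x + g x) = tInt f + tInt g :=
  intervalIntegral.integral_add (hf.intervalIntegrable _ _) (hg.intervalIntegrable _ _)

theorem tInt_sub {f g : ℝ → ℝ} (hf : Continuous f) (hg : Continuous g) :
    tInt (fun x => f x - g x) = tInt f - tInt g :=
  intervalIntegral.integral_sub (hf.intervalIntegrable _ _) (hg.intervalIntegrable _ _)

theorem tInt_const_mul (c : ℝ) (f : ℝ → ℝ) : tInt (fun x => c * f x) = c * tInt f :=
  intervalIntegral.integral_const_mul _ _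

theorem tInt_nonneg {f : ℝ → ℝ} (h : ∀ x, 0 ≤ f x) : 0 ≤ tInt f :=
  intervalIntegral.integral_nonneg (by norm_num) fun x _ => h x

/-- Cauchy–Schwarz over one period. -/
theorem tInt_mul_le {f g : ℝ → ℝ} (hf : Continuous f) (hg : Continuous g) :
    tInt (fun x => f x * g x) ≤ √(tInt (fun x => f x ^ 2)) * √(tInt fun x => g x ^ 2) := by
  set A := tInt fun x => f x ^ 2
  set B := tInt fun x => g x ^ 2
  set P := tInt fun x => f x * g x
  have hA : 0 ≤ A := tInt_nonneg fun x => sq_nonneg _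
  have hB : 0 ≤ B := tInt_nonneg fun x => sq_nonneg _
  have key : ∀ r : ℝ, 0 ≤ A * (r * r) + (-2 * P) * r + B := fun r => by
    have h0 : 0 ≤ tInt fun x => (r * f x - g x) ^ 2 := tInt_nonneg fun x => sq_nonneg _
    have h1 : (tInt fun x => (r * f x - g x) ^ 2) = A * (r * r) + (-2 * P) * r + B := by
      have : ∀ x, (r * f x - g x) ^ 2
          = (r ^ 2 * f x ^ 2 + (-2 * r) * (f x * g x)) + g x ^ 2 := fun x => by ring
      rw [tInt_congr this, tInt_add (by fun_prop) (by fun_prop),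
        tInt_add (by fun_prop) (by fun_prop), tInt_const_mul, tInt_const_mul]
      ring
    linarith
  have hd := discrim_le_zero key
  rw [discrim] at hd
  rw [← Real.sqrt_mul hA]
  exact Real.le_sqrt_of_sq_le (by linarith)

/-- The oscillation of a function over one period is bounded by its total variation. -/
theorem sub_le_tInt_abs {f f' : ℝ → ℝ} (hf : ∀ x, HasDerivAt f (f' x) x) (hc : Continuous f')
    {x y : ℝ} (hx : x ∈ Icc (-(1 / 2) : ℝ) (1 / 2)) (hy : y ∈ Icc (-(1 / 2) : ℝ) (1 / 2)) :
    f x - f y ≤ tInt fun z => |f' z| := by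
  rw [← intervalIntegral.integral_eq_sub_of_hasDerivAt (fun z _ => hf z)
    (hc.intervalIntegrable y x)]
  refine (le_abs_self _).trans ?_
  refine (intervalIntegral.norm_integral_le_integral_norm_uIoc
    (f := f') (a := y) (b := x) (μ := volume)).trans ?_
  rw [tInt, intervalIntegral.integral_of_le (by norm_num)]
  refine setIntegral_mono_set ?_ (.of_forall fun z => abs_nonneg _) ?_
  · exact (hc.abs.intervalIntegrable (-(1 / 2)) (1 / 2)).1
  · refine Filter.Eventually.of_forall fun z hz => ?_
    rcases mem_uIoc.1 hz with h | h
    · exact ⟨by linarith [hy.1, h.1], by linarith [hx.2, h.2]⟩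
    · exact ⟨by linarith [hx.1, h.1], by linarith [hy.2, h.2]⟩

/-- A continuous function attains a value not exceeding its mean. -/
theorem exists_le_tInt {f : ℝ → ℝ} (hf : Continuous f) :
    ∃ y ∈ Icc (-(1 / 2) : ℝ) (1 / 2), f y ≤ tInt f := by
  obtain ⟨y, hy, hmin⟩ := isCompact_Icc.exists_isMinOn
    (nonempty_Icc.2 (by norm_num : (-(1 / 2) : ℝ) ≤ 1 / 2)) hf.continuousOn
  refine ⟨y, hy, ?_⟩
  rw [← tInt_const (f y)]
  exact tInt_mono continuous_const hf fun x hx => hmin hx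

/-- An integrated differential inequality. -/
theorem integral_le_sub {f f' g : ℝ → ℝ} {t : ℝ} (ht : 0 ≤ t)
    (hf : ∀ s ∈ Icc 0 t, HasDerivAt f (f' s) s) (hc : ContinuousOn f' (Icc 0 t))
    (hg : ContinuousOn g (Icc 0 t)) (h : ∀ s ∈ Icc 0 t, g s ≤ f' s) :
    ∫ s in (0 : ℝ)..t, g s ≤ f t - f 0 := by
  have e : uIcc 0 t = Icc 0 t := uIcc_of_le ht
  rw [← intervalIntegral.integral_eq_sub_of_hasDerivAt (by rwa [e])
    (ContinuousOn.intervalIntegrable (by rwa [e]))]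
  exact intervalIntegral.integral_mono_on ht (ContinuousOn.intervalIntegrable (by rwa [e]))
    (ContinuousOn.intervalIntegrable (by rwa [e])) h

theorem kappa_pos {κ₁ κ₂ β v θ : ℝ} (h₁ : 0 < κ₁) (h₂ : 0 < κ₂) (hv : 0 < v) (hθ : 0 < θ) :
    0 < kappa κ₁ κ₂ β v θ := by
  have := rpow_pos_of_pos hθ β
  rw [kappa]; positivity

theorem eq_of_hasDerivAt_zero {f : ℝ → ℝ} {T : ℝ}
    (h : ∀ s ∈ Icc 0 T, HasDerivAt f 0 s) {t : ℝ} (ht : t ∈ Icc 0 T) : f t = f 0 := by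
  have := intervalIntegral.integral_eq_sub_of_hasDerivAt (f := f) (f' := fun _ => 0) (a := 0)
    (b := t) (fun s hs => by
      rw [uIcc_of_le ht.1] at hs
      exact h s ⟨hs.1, hs.2.trans ht.2⟩) (by simp)
  simp only [intervalIntegral.integral_zero] at this
  linarith

namespace Sol

variable {μ R a b κ₁ κ₂ β γ T : ℝ} (S : Sol μ R a b κ₁ κ₂ β γ T)

theorem sv : Smooth S.v := S.smooth_v
theorem su : Smooth S.u := S.smooth_u
theorem sθ : Smooth S.θ := S.smooth_θ
theorem sq : Smooth S.q := S.smooth_q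

theorem smooth_kappa : Smooth fun t x => kappa κ₁ κ₂ β (S.v t x) (S.θ t x) :=
  (Smooth.const κ₁).add (((Smooth.const κ₂).mul S.sv).mul (S.sθ.rpow S.θ_pos β))

/-- The conductive heat flux `κ θ_x / v`. -/
def heatFlux (t x : ℝ) : ℝ := kappa κ₁ κ₂ β (S.v t x) (S.θ t x) * px S.θ t x / S.v t x

/-- The pressure `R θ / v`. -/
def pressure (t x : ℝ) : ℝ := R * S.θ t x / S.v t x

/-- The viscous stress `μ u_x / v`. -/
def viscous (t x : ℝ) : ℝ := μ * px S.u t x / S.v t x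

/-- The total stress `μ u_x / v - R θ / v`. -/
def stress (t x : ℝ) : ℝ := S.viscous t x - S.pressure t x

/-- The entropy dissipation due to heat conduction, `∫ κ θ_x² / (v θ²)`. -/
def dissip (t : ℝ) : ℝ :=
  tInt fun x => kappa κ₁ κ₂ β (S.v t x) (S.θ t x) * px S.θ t x ^ 2 / (S.v t x * S.θ t x ^ 2)

theorem smooth_heatFlux : Smooth S.heatFlux := (S.smooth_kappa.mul S.sθ.px).div S.sv S.v_pos

theorem smooth_pressure : Smooth S.pressure := ((Smooth.const R).mul S.sθ).div S.sv S.v_pos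

theorem smooth_viscous : Smooth S.viscous := ((Smooth.const μ).mul S.su.px).div S.sv S.v_pos

theorem smooth_stress : Smooth S.stress := S.smooth_viscous.sub S.smooth_pressure

theorem smooth_dissip : Smooth fun t x =>
    kappa κ₁ κ₂ β (S.v t x) (S.θ t x) * px S.θ t x ^ 2 / (S.v t x * S.θ t x ^ 2) :=
  (S.smooth_kappa.mul (S.sθ.px.pow 2)).div (S.sv.mul (S.sθ.pow 2)) fun t x =>
    mul_pos (S.v_pos t x) (pow_pos (S.θ_pos t x) 2)

theorem periodic_stress (t : ℝ) : Function.Periodic (S.stress t) 1 := fun x => by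
  simp only [stress, viscous, pressure, S.periodic_v t x, S.periodic_θ t x,
    px_periodic S.periodic_u t x]

theorem pt_v {t : ℝ} (ht : t ∈ Icc 0 T) (x : ℝ) : pt S.v t x = px S.u t x := by
  linarith [S.eq_mass t ht x]

theorem pt_u {t : ℝ} (ht : t ∈ Icc 0 T) (x : ℝ) : pt S.u t x = px S.stress t x := by
  have h := S.eq_mom t ht x
  have e : px S.stress t x = px S.viscous t x - px S.pressure t x :=
    ((S.smooth_viscous.hasDerivAt_px t x).sub (S.smooth_pressure.hasDerivAt_px t x)).deriv
  rw [e]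
  change pt S.u t x + px S.pressure t x = px S.viscous t x at h
  linarith

theorem pt_energyDensity (t x : ℝ) :
    pt (fun s y => R / (γ - 1) * S.θ s y + S.u s y ^ 2 / 2) t x =
      R / (γ - 1) * pt S.θ t x + S.u t x * pt S.u t x := by
  refine HasDerivAt.deriv (HasDerivAt.congr_deriv
    (((S.sθ.hasDerivAt_pt t x).const_mul (R / (γ - 1))).add
      (((S.su.hasDerivAt_pt t x).pow 2).div_const 2)) ?_)
  push_cast; ring

/-- The balance law for the internal energy. -/
theorem temperature_eq {t : ℝ} (ht : t ∈ Icc 0 T) (x : ℝ) :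
    R / (γ - 1) * pt S.θ t x + S.pressure t x * px S.u t x + px S.q t x =
      S.viscous t x * px S.u t x + px S.heatFlux t x := by
  have h := S.eq_energy t ht x
  have hm := S.eq_mom t ht x
  change pt S.u t x + px S.pressure t x = px S.viscous t x at hm
  have e2 : px (fun s y => R * S.θ s y / S.v s y * S.u s y) t x =
      px S.pressure t x * S.u t x + S.pressure t x * px S.u t x :=
    ((S.smooth_pressure.hasDerivAt_px t x).mul (S.su.hasDerivAt_px t x)).deriv
  have e3 : px (fun s y => μ * S.u s y * px S.u s y / S.v s y) t x =
      px S.viscous t x * S.u t x + S.viscous t x * px S.u t x := by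
    have : (fun s y => μ * S.u s y * px S.u s y / S.v s y) =
        fun s y => S.viscous s y * S.u s y := by
      funext s y; rw [viscous]; ring
    rw [this]
    exact ((S.smooth_viscous.hasDerivAt_px t x).mul (S.su.hasDerivAt_px t x)).deriv
  have e4 : px (fun s y => kappa κ₁ κ₂ β (S.v s y) (S.θ s y) * px S.θ s y / S.v s y) t x =
    px S.heatFlux t x := rfl
  rw [S.pt_energyDensity, e2, e3, e4] at h
  linear_combination h - S.u t x * hm

theorem tInt_v {t : ℝ} (ht : t ∈ Icc 0 T) : tInt (S.v t) = 1 := by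
  rw [← S.mean_v]
  refine eq_of_hasDerivAt_zero (f := fun t => tInt (S.v t)) (fun s hs => ?_) ht
  have := S.sv.hasDerivAt_tInt s
  rwa [tInt_congr (S.pt_v hs), tInt_px S.su s (S.periodic_u s)] at this

theorem tInt_u {t : ℝ} (ht : t ∈ Icc 0 T) : tInt (S.u t) = tInt (S.u 0) := by
  refine eq_of_hasDerivAt_zero (f := fun t => tInt (S.u t)) (fun s hs => ?_) ht
  have := S.su.hasDerivAt_tInt s
  rwa [tInt_congr (S.pt_u hs), tInt_px S.smooth_stress s (S.periodic_stress s)] at this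

/-- The total energy `∫ (c_v θ + u²/2)`. -/
def energy (t : ℝ) : ℝ := tInt fun x => R / (γ - 1) * S.θ t x + S.u t x ^ 2 / 2

theorem energy_eq {t : ℝ} (ht : t ∈ Icc 0 T) : S.energy t = S.energy 0 := by
  refine eq_of_hasDerivAt_zero (f := S.energy) (fun s hs => ?_) ht
  have hF : Smooth fun t x => R / (γ - 1) * S.θ t x + S.u t x ^ 2 / 2 :=
    ((Smooth.const _).mul S.sθ).add ((S.su.pow 2).div (Smooth.const 2) fun _ _ => two_pos)
  have h := hF.hasDerivAt_tInt s
  have hG : Smooth fun t x => S.stress t x * S.u t x + S.heatFlux t x - S.q t x :=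
    ((S.smooth_stress.mul S.su).add S.smooth_heatFlux).sub S.sq
  have hp : Function.Periodic (fun x => S.stress s x * S.u s x + S.heatFlux s x - S.q s x) 1 :=
    fun x => by
      simp only [S.periodic_stress s x, heatFlux, S.periodic_v s x, S.periodic_θ s x,
        S.periodic_u s x, S.periodic_q s x, px_periodic S.periodic_θ s x]
  have e : ∀ x, pt (fun t x => R / (γ - 1) * S.θ t x + S.u t x ^ 2 / 2) s x =
      px (fun t x => S.stress t x * S.u t x + S.heatFlux t x - S.q t x) s x := fun x => by
    have e2 : px (fun t x => S.stress t x * S.u t x + S.heatFlux t x - S.q t x) s x =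
        px S.stress s x * S.u s x + S.stress s x * px S.u s x + px S.heatFlux s x - px S.q s x :=
      ((((S.smooth_stress.hasDerivAt_px s x).mul (S.su.hasDerivAt_px s x)).add
        (S.smooth_heatFlux.hasDerivAt_px s x)).sub (S.sq.hasDerivAt_px s x)).deriv
    have h1 := S.temperature_eq hs x
    have h2 := S.pt_u hs x
    have h3 : S.stress s x = S.viscous s x - S.pressure s x := rfl
    rw [S.pt_energyDensity, e2, h2, h3]
    linear_combination h1
  rwa [tInt_congr e, tInt_px hG s hp] at h

/-- The radiation energy density `b θ⁴ - q_x / v`. -/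
def radEnergy (t x : ℝ) : ℝ := b * S.θ t x ^ 4 - px S.q t x / S.v t x

theorem smooth_radEnergy : Smooth S.radEnergy :=
  ((Smooth.const b).mul (S.sθ.pow 4)).sub (S.sq.px.div S.sv S.v_pos)

theorem px_radEnergy {t : ℝ} (ht : t ∈ Icc 0 T) (x : ℝ) :
    px S.radEnergy t x = -(a * S.v t x * S.q t x) := by
  have h := S.eq_rad t ht x
  have e : px S.radEnergy t x = b * px (fun s y => S.θ s y ^ 4) t x -
      px (fun s y => px S.q s y / S.v s y) t x :=
    ((((S.sθ.pow 4).hasDerivAt_px t x).const_mul b).sub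
      ((S.sq.px.div S.sv S.v_pos).hasDerivAt_px t x)).deriv
  linarith

theorem periodic_radEnergy (t : ℝ) : Function.Periodic (S.radEnergy t) 1 := fun x => by
  simp only [radEnergy, S.periodic_v t x, S.periodic_θ t x, px_periodic S.periodic_q t x]

theorem radEnergy_pos (ha : 0 < a) (hb : 0 < b) {t : ℝ} (ht : t ∈ Icc 0 T) (x : ℝ) :
    0 < S.radEnergy t x := by
  have hc := S.smooth_radEnergy.continuous_px t
  obtain ⟨y, -, hy⟩ := isCompact_Icc.exists_isMinOn
    (nonempty_Icc.2 (by norm_num : (0 : ℝ) ≤ 1)) hc.continuousOn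
  have hmin : ∀ z, S.radEnergy t y ≤ S.radEnergy t z := fun z => by
    obtain ⟨w, hw, e⟩ := (S.periodic_radEnergy t).exists_mem_Ico₀ one_pos z
    rw [e]; exact hy (Ico_subset_Icc_self hw)
  refine lt_of_lt_of_le ?_ (hmin x)
  have hloc : IsLocalMin (S.radEnergy t) y := .of_forall hmin
  have hd : px S.radEnergy t y = 0 := hloc.deriv_eq_zero
  have hq : S.q t y = 0 := by
    rw [S.px_radEnergy ht] at hd
    simpa [ha.ne', (S.v_pos t y).ne'] using hd
  have hdd : deriv (deriv (S.radEnergy t)) y = -(a * S.v t y * px S.q t y) := by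
    have : deriv (S.radEnergy t) = fun x => -(a * S.v t x * S.q t x) :=
      funext (S.px_radEnergy ht)
    rw [this]
    refine HasDerivAt.deriv (HasDerivAt.congr_deriv
      (((S.sv.hasDerivAt_px t y).const_mul a).mul (S.sq.hasDerivAt_px t y)).neg ?_)
    rw [hq]; ring
  have hqx : px S.q t y ≤ 0 := by
    by_contra! hpos
    have hneg : deriv (deriv (S.radEnergy t)) y < 0 := by
      have := S.v_pos t y
      rw [hdd]; have : 0 < a * S.v t y * px S.q t y := by positivity
      linarith
    have hmax := isLocalMax_of_deriv_deriv_neg hneg hloc.deriv_eq_zero hc.continuousAt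
    have hconst : S.radEnergy t =ᶠ[nhds y] fun _ => S.radEnergy t y :=
      hmax.mono fun z hz => le_antisymm hz (hmin z)
    have := hconst.deriv.deriv_eq
    simp only [deriv_const', deriv_const] at this
    exact absurd this hneg.ne
  have h1 : px S.q t y / S.v t y ≤ 0 := div_nonpos_of_nonpos_of_nonneg hqx (S.v_pos t y).le
  have h2 : 0 < b * S.θ t y ^ 4 := mul_pos hb (pow_pos (S.θ_pos t y) 4)
  rw [radEnergy]; linarith

/-- Radiation produces entropy. -/
theorem tInt_rad_le (ha : 0 < a) (hb : 0 < b) {t : ℝ} (ht : t ∈ Icc 0 T) :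
    tInt (fun x => px S.q t x / S.θ t x) ≤ 0 := by
  have hN := S.radEnergy_pos ha hb ht
  have hm : ∀ x, 0 < S.radEnergy t x / b := fun x => div_pos (hN x) hb
  set h : ℝ → ℝ := fun x => (S.radEnergy t x / b) ^ (-(1 / 4) : ℝ) with hh
  set h' : ℝ → ℝ := fun x => -(a * S.v t x * S.q t x) / b * (-(1 / 4)) *
    (S.radEnergy t x / b) ^ (-(1 / 4) - 1 : ℝ) with hh'
  have hd : ∀ x, HasDerivAt h (h' x) x := fun x => by
    have h1 := S.smooth_radEnergy.hasDerivAt_px t x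
    rw [S.px_radEnergy ht] at h1
    exact (h1.div_const b).rpow_const (Or.inl (hm x).ne')
  have cv := S.sv.continuous_px t
  have cq := S.sq.continuous_px t
  have cθ := S.sθ.continuous_px t
  have cqx := S.sq.px.continuous_px t
  have cN := S.smooth_radEnergy.continuous_px t
  have ch : Continuous h := (cN.div_const b).rpow_const fun x => Or.inl (hm x).ne'
  have ch' : Continuous h' := Continuous.mul (by fun_prop)
    ((cN.div_const b).rpow_const fun x => Or.inl (hm x).ne')
  have hz : tInt (fun x => px S.q t x * h x + S.q t x * h' x) = 0 := by
    refine tInt_deriv (g := fun x => S.q t x * h x)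
      (fun x => (S.sq.hasDerivAt_px t x).mul (hd x)) (by fun_prop) ?_
    simp only [hh, Periodic.half (S.periodic_q t), Periodic.half (S.periodic_radEnergy t)]
  rw [← hz]
  refine tInt_mono (cqx.div cθ fun x => (S.θ_pos t x).ne') (by fun_prop) fun x _ => ?_
  have hθ := S.θ_pos t x
  have hv := S.v_pos t x
  have h1 : 0 ≤ S.q t x * h' x := by
    have : 0 < (S.radEnergy t x / b) ^ (-(1 / 4) - 1 : ℝ) := rpow_pos_of_pos (hm x) _
    have e : S.q t x * h' x = S.q t x ^ 2 * (a * S.v t x / b / 4 *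
        (S.radEnergy t x / b) ^ (-(1 / 4) - 1 : ℝ)) := by
      simp only [hh']; ring
    rw [e]; positivity
  set m : ℝ := (S.radEnergy t x / b) ^ (1 / 4 : ℝ) with hmdef
  have hmpos : 0 < m := rpow_pos_of_pos (hm x) _
  have hm4 : b * m ^ 4 = S.radEnergy t x := by
    rw [hmdef, ← rpow_natCast, ← rpow_mul (hm x).le]
    norm_num
    field_simp
  have hhm : h x = 1 / m := by
    simp only [hh, hmdef]; rw [rpow_neg (hm x).le, ← one_div]
  have hqx : px S.q t x = S.v t x * b * (S.θ t x ^ 4 - m ^ 4) := by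
    have : S.radEnergy t x = b * S.θ t x ^ 4 - px S.q t x / S.v t x := rfl
    rw [← hm4] at this
    field_simp at this
    linear_combination this
  have h2 : px S.q t x * h x - px S.q t x / S.θ t x =
      S.v t x * b * ((S.θ t x - m) ^ 2 * ((S.θ t x + m) * (S.θ t x ^ 2 + m ^ 2)) /
        (m * S.θ t x)) := by
    rw [hqx, hhm]; field_simp; ring
  have h3 : 0 ≤ S.v t x * b * ((S.θ t x - m) ^ 2 * ((S.θ t x + m) * (S.θ t x ^ 2 + m ^ 2)) /
        (m * S.θ t x)) := by positivity
  linarith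

/-- The entropy `∫ (c_v log θ + R log v)`. -/
def entropy (t : ℝ) : ℝ := tInt fun x => R / (γ - 1) * log (S.θ t x) + R * log (S.v t x)

theorem continuous_dissip : Continuous S.dissip := continuous_tInt S.smooth_dissip.continuous

theorem dissip_nonneg (hκ₁ : 0 < κ₁) (hκ₂ : 0 < κ₂) (t : ℝ) : 0 ≤ S.dissip t :=
  tInt_nonneg fun x => by
    have := S.v_pos t x
    have := kappa_pos (β := β) hκ₁ hκ₂ (S.v_pos t x) (S.θ_pos t x)
    positivity

theorem integral_dissip_le (hμ : 0 < μ) (ha : 0 < a) (hb : 0 < b) {t : ℝ} (ht : t ∈ Icc 0 T) :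
    ∫ s in (0 : ℝ)..t, S.dissip s ≤ S.entropy t - S.entropy 0 := by
  have hF : Smooth fun t x => R / (γ - 1) * log (S.θ t x) + R * log (S.v t x) :=
    ((Smooth.const _).mul (S.sθ.log S.θ_pos)).add ((Smooth.const _).mul (S.sv.log S.v_pos))
  refine integral_le_sub ht.1 (fun s _ => hF.hasDerivAt_tInt s)
    (continuous_tInt hF.pt.continuous).continuousOn S.continuous_dissip.continuousOn
    fun s hs => ?_
  have hs' : s ∈ Icc 0 T := ⟨hs.1, hs.2.trans ht.2⟩
  have hG : Smooth fun t x => S.heatFlux t x / S.θ t x := S.smooth_heatFlux.div S.sθ S.θ_pos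
  have hp : Function.Periodic (fun x => S.heatFlux s x / S.θ s x) 1 := fun x => by
    simp only [heatFlux, S.periodic_v s x, S.periodic_θ s x, px_periodic S.periodic_θ s x]
  have hz := tInt_px hG s hp
  have hr := S.tInt_rad_le ha hb hs'
  have cq : Continuous fun x => px S.q s x / S.θ s x :=
    (S.sq.px.div S.sθ S.θ_pos).continuous_px s
  have cD := S.smooth_dissip.continuous_px s
  have cG := hG.px.continuous_px s
  have key : tInt (fun x => kappa κ₁ κ₂ β (S.v s x) (S.θ s x) * px S.θ s x ^ 2 /
      (S.v s x * S.θ s x ^ 2) + px (fun t x => S.heatFlux t x / S.θ t x) s x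
      - px S.q s x / S.θ s x) ≤
      tInt (pt (fun t x => R / (γ - 1) * log (S.θ t x) + R * log (S.v t x)) s) := by
    refine tInt_mono (by fun_prop) (hF.pt.continuous_px s) fun x _ => ?_
    have hθ := S.θ_pos s x
    have hv := S.v_pos s x
    have e1 : pt (fun t x => R / (γ - 1) * log (S.θ t x) + R * log (S.v t x)) s x =
        R / (γ - 1) * (pt S.θ s x / S.θ s x) + R * (pt S.v s x / S.v s x) :=
      ((((S.sθ.hasDerivAt_pt s x).log hθ.ne').const_mul _).add
        (((S.sv.hasDerivAt_pt s x).log hv.ne').const_mul _)).deriv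
    have e2 : px (fun t x => S.heatFlux t x / S.θ t x) s x =
        (px S.heatFlux s x * S.θ s x - S.heatFlux s x * px S.θ s x) / S.θ s x ^ 2 :=
      ((S.smooth_heatFlux.hasDerivAt_px s x).div (S.sθ.hasDerivAt_px s x) hθ.ne').deriv
    have h1 := S.temperature_eq hs' x
    have h2 : 0 ≤ S.viscous s x * px S.u s x / S.θ s x := by
      have : S.viscous s x * px S.u s x = μ * px S.u s x ^ 2 / S.v s x := by
        rw [viscous]; ring
      rw [this]; positivity
    have e3 : R / (γ - 1) * pt S.θ s x = S.viscous s x * px S.u s x + px S.heatFlux s x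
      - S.pressure s x * px S.u s x - px S.q s x := by linarith
    have e4 : R / (γ - 1) * (pt S.θ s x / S.θ s x) = (S.viscous s x * px S.u s x
        + px S.heatFlux s x - S.pressure s x * px S.u s x - px S.q s x) / S.θ s x := by
      rw [← e3]; ring
    rw [e1, e2, e4, S.pt_v hs' x]
    refine le_of_sub_nonneg (h2.trans_eq ?_)
    simp only [pressure, heatFlux]
    field_simp
    ring
  rw [tInt_sub (by fun_prop) cq, tInt_add cD cG, hz] at key
  change S.dissip s + 0 - _ ≤ _ at key
  linarith

end Sol

/-- A one-dimensional Sobolev-type bound for powers of a positive periodic function. -/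
theorem sq_rpow_le {f f' : ℝ → ℝ} (hf : ∀ x, HasDerivAt f (f' x) x) (hc : Continuous f')
    (hpos : ∀ x, 0 < f x) {E p : ℝ} (hE : tInt f ≤ E) (hp : 0 < p)
    {x : ℝ} (hx : x ∈ Icc (-(1 / 2) : ℝ) (1 / 2)) :
    (f x ^ p) ^ 2 ≤ 2 * (E ^ p) ^ 2 + 2 * p ^ 2 * E * tInt fun z => f z ^ (2 * p - 3) * f' z ^ 2 := by
  have cf : Continuous f := continuous_iff_continuousAt.2 fun z => (hf z).continuousAt
  have cr : ∀ r : ℝ, Continuous fun z => f z ^ r := fun r =>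
    cf.rpow_const fun z => Or.inl (hpos z).ne'
  have hE0 : 0 ≤ E := (tInt_nonneg fun z => (hpos z).le).trans hE
  obtain ⟨y, hy, hfy⟩ := exists_le_tInt cf
  have h1 : f y ^ p ≤ E ^ p := rpow_le_rpow (hpos y).le (hfy.trans hE) hp.le
  have h2 := sub_le_tInt_abs (f := fun z => f z ^ p) (f' := fun z => f' z * p * f z ^ (p - 1))
    (fun z => (hf z).rpow_const (Or.inl (hpos z).ne')) ((hc.mul continuous_const).mul (cr _)) hx hy
  have h3 : (tInt fun z => |f' z * p * f z ^ (p - 1)|) =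
      p * tInt fun z => (f z ^ (p - 3 / 2) * |f' z|) * √(f z) := by
    rw [← tInt_const_mul]
    refine tInt_congr fun z => ?_
    have e : f z ^ (p - 1) = f z ^ (p - 3 / 2) * √(f z) := by
      rw [sqrt_eq_rpow, ← rpow_add (hpos z)]; congr 1; ring
    rw [abs_mul, abs_mul, abs_of_pos hp, abs_of_pos (rpow_pos_of_pos (hpos z) _), e]
    ring
  have h4 := tInt_mul_le (f := fun z => f z ^ (p - 3 / 2) * |f' z|) (g := fun z => √(f z))
    ((cr _).mul hc.abs) cf.sqrt
  have e1 : (tInt fun z => (f z ^ (p - 3 / 2) * |f' z|) ^ 2) =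
      tInt fun z => f z ^ (2 * p - 3) * f' z ^ 2 := tInt_congr fun z => by
    rw [mul_pow, sq_abs, ← rpow_natCast, ← rpow_mul (hpos z).le]
    congr 2; push_cast; ring
  have e2 : (tInt fun z => √(f z) ^ 2) = tInt f := tInt_congr fun z => sq_sqrt (hpos z).le
  rw [e1, e2] at h4
  set I := tInt fun z => f z ^ (2 * p - 3) * f' z ^ 2
  have hI : 0 ≤ I := tInt_nonneg fun z =>
    mul_nonneg (rpow_pos_of_pos (hpos z) _).le (sq_nonneg _)
  have h5 : √I * √(tInt f) ≤ √I * √E := by gcongr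
  have h6 : f x ^ p ≤ E ^ p + p * (√I * √E) := by
    rw [h3] at h2
    have := mul_le_mul_of_nonneg_left (h4.trans h5) hp.le
    linarith
  calc (f x ^ p) ^ 2 ≤ (E ^ p + p * (√I * √E)) ^ 2 :=
        pow_le_pow_left₀ (rpow_pos_of_pos (hpos x) _).le h6 2
    _ ≤ 2 * (E ^ p) ^ 2 + 2 * (p * (√I * √E)) ^ 2 := by
        nlinarith [sq_nonneg (E ^ p - p * (√I * √E))]
    _ = _ := by rw [mul_pow, mul_pow, sq_sqrt hI, sq_sqrt hE0]; ring

theorem tInt_abs_le_of_sq {f : ℝ → ℝ} (hf : Continuous f) {E : ℝ}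
    (h : tInt (fun x => f x ^ 2) ≤ E) : tInt (fun x => |f x|) ≤ (1 + E) / 2 := by
  have : tInt (fun x => |f x|) ≤ tInt fun x => (1 / 2) * (1 + f x ^ 2) :=
    tInt_mono hf.abs (by fun_prop) fun x _ => by
      nlinarith [sq_nonneg (|f x| - 1), sq_abs (f x)]
  rw [tInt_const_mul, tInt_add (by fun_prop) (by fun_prop), tInt_const] at this
  linarith

namespace Sol

variable {μ R a b κ₁ κ₂ β γ T M ε : ℝ} {S : Sol μ R a b κ₁ κ₂ β γ T}

theorem Bounded.l2sq_le (hM : 1 ≤ M) (h : S.Bounded M ε) :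
    L2sq (S.v 0) ≤ M ^ 2 ∧ L2sq (px S.v 0) ≤ M ^ 2 ∧ L2sq (S.u 0) ≤ M ^ 2 ∧
      L2sq (S.θ 0) ≤ M ^ 2 := by
  have h1 := (sqrt_le_left (by linarith)).1 h.1
  have h0 : ∀ f, 0 ≤ L2sq f := fun f => tInt_nonneg fun x => sq_nonneg (f x)
  simp only [H2sq] at h1
  have e : px S.v 0 = deriv (S.v 0) := rfl
  rw [e]
  have := h0 (S.v 0); have := h0 (deriv (S.v 0)); have := h0 (deriv (deriv (S.v 0)))
  have := h0 (S.u 0); have := h0 (deriv (S.u 0)); have := h0 (deriv (deriv (S.u 0)))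
  have := h0 (S.θ 0); have := h0 (deriv (S.θ 0)); have := h0 (deriv (deriv (S.θ 0)))
  refine ⟨?_, ?_, ?_, ?_⟩ <;> linarith

/-- Uniform bounds on the mass of `θ` and the `L²` norm of `u`. -/
theorem exists_energy_bound (μ R a b κ₁ κ₂ β γ T M ε : ℝ) (hR : 0 < R) (hγ : 1 < γ)
    (hM : 1 ≤ M) :
    ∃ E : ℝ, 0 < E ∧ ∀ S : Sol μ R a b κ₁ κ₂ β γ T, S.Bounded M ε → ∀ t ∈ Icc (0 : ℝ) T,
      tInt (S.θ t) ≤ E ∧ tInt (fun x => S.u t x ^ 2) ≤ E := by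
  have hg : 0 < γ - 1 := by linarith
  have hcv : 0 < R / (γ - 1) := by positivity
  set cv := R / (γ - 1) with hcvdef
  set E₀ : ℝ := cv * ((1 + M ^ 2) / 2) + M ^ 2 / 2 with hE0
  have hE₀ : 0 < E₀ := by positivity
  refine ⟨E₀ / cv + 2 * E₀, by positivity, fun S hS t ht => ?_⟩
  have hexp : ∀ s, S.energy s = cv * tInt (S.θ s) + 1 / 2 * tInt fun x => S.u s x ^ 2 := fun s => by
    have cθ := S.sθ.continuous_px s
    have cu := S.su.continuous_px s
    have : ∀ x, R / (γ - 1) * S.θ s x + S.u s x ^ 2 / 2 =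
        cv * S.θ s x + 1 / 2 * S.u s x ^ 2 := fun x => by rw [hcvdef]; ring
    rw [energy, tInt_congr this, tInt_add (by fun_prop) (by fun_prop), tInt_const_mul,
      tInt_const_mul]
  obtain ⟨-, -, hu, hθ⟩ := hS.l2sq_le hM
  have h0 : S.energy 0 ≤ E₀ := by
    have h1 := tInt_abs_le_of_sq (S.sθ.continuous_px 0) hθ
    rw [tInt_congr fun x => abs_of_pos (S.θ_pos 0 x)] at h1
    change tInt (S.θ 0) ≤ _ at h1
    change (tInt fun x => S.u 0 x ^ 2) ≤ _ at hu
    rw [hexp 0]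
    have := mul_le_mul_of_nonneg_left h1 hcv.le
    linarith
  rw [← S.energy_eq ht, hexp t] at h0
  have hθ0 : 0 ≤ tInt (S.θ t) := tInt_nonneg fun x => (S.θ_pos t x).le
  have hu0 : 0 ≤ tInt fun x => S.u t x ^ 2 := tInt_nonneg fun x => sq_nonneg _
  have hθ1 : tInt (S.θ t) ≤ E₀ / cv := by
    rw [le_div_iff₀ hcv]; linarith
  have : 0 < E₀ / cv := by positivity
  have : 0 ≤ cv * tInt (S.θ t) := by positivity
  constructor <;> linarith

theorem exists_dissip_bound (μ R a b κ₁ κ₂ β γ T M ε : ℝ) (hμ : 0 < μ) (hR : 0 < R)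
    (ha : 0 < a) (hb : 0 < b) (hγ : 1 < γ) (hM : 1 ≤ M) (hε : 0 < ε) :
    ∃ K : ℝ, 0 < K ∧ ∀ S : Sol μ R a b κ₁ κ₂ β γ T, S.Bounded M ε → ∀ t ∈ Icc (0 : ℝ) T,
      ∫ s in (0 : ℝ)..t, S.dissip s ≤ K := by
  obtain ⟨E, hE, hbd⟩ := exists_energy_bound μ R a b κ₁ κ₂ β γ T M ε hR hγ hM
  have hg : 0 < γ - 1 := by linarith
  have hcv : 0 < R / (γ - 1) := by positivity
  set cv := R / (γ - 1) with hcvdef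
  refine ⟨cv * E + R + |cv * log ε + R * log ε|, by positivity, fun S hS t ht => ?_⟩
  refine (S.integral_dissip_le hμ ha hb ht).trans ?_
  have cθ : ∀ s, Continuous (S.θ s) := fun s => S.sθ.continuous_px s
  have cv' : ∀ s, Continuous (S.v s) := fun s => S.sv.continuous_px s
  have clθ : ∀ s, Continuous fun x => log (S.θ s x) := fun s =>
    (cθ s).log fun x => (S.θ_pos s x).ne'
  have clv : ∀ s, Continuous fun x => log (S.v s x) := fun s =>
    (cv' s).log fun x => (S.v_pos s x).ne'
  have hup : S.entropy t ≤ cv * E + R := by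
    have h1 : S.entropy t ≤ tInt fun x => cv * S.θ t x + R * S.v t x := by
      refine tInt_mono (((clθ t).const_mul _).add ((clv t).const_mul _))
        (((cθ t).const_mul _).add ((cv' t).const_mul _)) fun x _ => ?_
      have h1 := (log_le_sub_one_of_pos (S.θ_pos t x)).trans (sub_le_self _ zero_le_one)
      have h2 := (log_le_sub_one_of_pos (S.v_pos t x)).trans (sub_le_self _ zero_le_one)
      gcongr
    rw [tInt_add ((cθ t).const_mul _) ((cv' t).const_mul _), tInt_const_mul, tInt_const_mul] at h1
    have h2 := S.tInt_v ht
    have h3 := mul_le_mul_of_nonneg_left (hbd S hS t ht).1 hcv.le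
    change S.entropy t ≤ cv * tInt (S.θ t) + R * tInt (S.v t) at h1
    rw [h2] at h1
    linarith
  have hlow : cv * log ε + R * log ε ≤ S.entropy 0 := by
    rw [← tInt_const (cv * log ε + R * log ε)]
    refine tInt_mono continuous_const (((clθ 0).const_mul _).add ((clv 0).const_mul _))
      fun x _ => ?_
    have h1 := log_le_log hε (hS.2.1 x)
    have h2 := log_le_log hε (hS.2.2 x)
    gcongr
  linarith [neg_abs_le (cv * log ε + R * log ε)]

theorem exists_theta_le_dissip (μ R a b κ₁ κ₂ β γ T M ε : ℝ) (hR : 0 < R)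
    (hκ₁ : 0 < κ₁) (hκ₂ : 0 < κ₂) (hβ : 0 < β) (hγ : 1 < γ) (hM : 1 ≤ M) :
    ∃ C : ℝ, 0 < C ∧ ∀ S : Sol μ R a b κ₁ κ₂ β γ T, S.Bounded M ε → ∀ t ∈ Icc (0 : ℝ) T,
      ∀ x ∈ Icc (-(1 / 2) : ℝ) (1 / 2), S.θ t x ≤ C * (1 + S.dissip t) := by
  obtain ⟨E, hE, hbd⟩ := exists_energy_bound μ R a b κ₁ κ₂ β γ T M ε hR hγ hM
  set p := (β + 1) / 2 with hp
  refine ⟨1 + 2 * (E ^ p) ^ 2 + 2 * p ^ 2 * E / κ₂, by positivity, fun S hS t ht x hx => ?_⟩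
  have h1 := sq_rpow_le (S.sθ.hasDerivAt_px t) (S.sθ.px.continuous_px t) (S.θ_pos t)
    (hbd S hS t ht).1 (by positivity : 0 < p) hx
  have h2 : (tInt fun z => S.θ t z ^ (2 * p - 3) * px S.θ t z ^ 2) ≤ 1 / κ₂ * S.dissip t := by
    rw [dissip, ← tInt_const_mul]
    refine tInt_mono (((S.sθ.rpow S.θ_pos _).mul (S.sθ.px.pow 2)).continuous_px t)
      ((S.smooth_dissip.continuous_px t).const_mul _) fun z _ => ?_
    have hv := S.v_pos t z
    have hθ := S.θ_pos t z
    have hr : S.θ t z ^ (2 * p - 3) = S.θ t z ^ β / S.θ t z ^ 2 := by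
      rw [← rpow_natCast, ← rpow_sub hθ]; congr 1; rw [hp]; push_cast; ring
    have e : 1 / κ₂ * (kappa κ₁ κ₂ β (S.v t z) (S.θ t z) * px S.θ t z ^ 2 /
        (S.v t z * S.θ t z ^ 2)) = S.θ t z ^ (2 * p - 3) * px S.θ t z ^ 2 +
        κ₁ / κ₂ * (px S.θ t z ^ 2 / (S.v t z * S.θ t z ^ 2)) := by
      rw [hr, kappa]; field_simp; ring
    rw [e]
    exact le_add_of_nonneg_right (by positivity)
  have h3 : S.θ t x ≤ 1 + (S.θ t x ^ p) ^ 2 := by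
    have hθ := S.θ_pos t x
    have e : (S.θ t x ^ p) ^ 2 = S.θ t x ^ (β + 1) := by
      rw [← rpow_natCast, ← rpow_mul hθ.le]; congr 1; rw [hp]; push_cast; ring
    rcases le_total (S.θ t x) 1 with h | h
    · nlinarith [sq_nonneg (S.θ t x ^ p)]
    · have := rpow_le_rpow_of_exponent_le h (by linarith : (1 : ℝ) ≤ β + 1)
      rw [rpow_one, ← e] at this
      linarith
  have h4 := mul_le_mul_of_nonneg_left h2 (by positivity : 0 ≤ 2 * p ^ 2 * E)
  have hD := S.dissip_nonneg hκ₁ hκ₂ t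
  have h5 : 0 ≤ (1 + 2 * (E ^ p) ^ 2) * S.dissip t + 2 * p ^ 2 * E / κ₂ := by positivity
  have h6 : 2 * p ^ 2 * E * (1 / κ₂ * S.dissip t) = 2 * p ^ 2 * E / κ₂ * S.dissip t := by ring
  linarith

theorem tInt_le_Y (S : Sol μ R a b κ₁ κ₂ β γ T) {s t : ℝ} (hs : s ∈ Icc 0 t) :
    tInt (fun x => (kappa κ₁ κ₂ β (S.v s x) (S.θ s x)) ^ 2 * (px S.θ s x) ^ 2 / (S.v s x) ^ 2)
      ≤ S.Y t := by
  have hc : Smooth fun s x =>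
      (kappa κ₁ κ₂ β (S.v s x) (S.θ s x)) ^ 2 * (px S.θ s x) ^ 2 / (S.v s x) ^ 2 :=
    ((S.smooth_kappa.pow 2).mul (S.sθ.px.pow 2)).div (S.sv.pow 2)
      fun t x => pow_pos (S.v_pos t x) 2
  exact le_csSup (isCompact_Icc.image (continuous_tInt hc.continuous)).bddAbove ⟨s, hs, rfl⟩

theorem Y_nonneg (S : Sol μ R a b κ₁ κ₂ β γ T) {t : ℝ} (ht : 0 ≤ t) : 0 ≤ S.Y t :=
  (tInt_nonneg fun x => by positivity).trans (S.tInt_le_Y ⟨le_rfl, ht⟩)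

theorem exists_theta_le_Y (μ R a b κ₁ κ₂ β γ T M ε : ℝ) (hR : 0 < R)
    (hκ₁ : 0 < κ₁) (hκ₂ : 0 < κ₂) (hβ : 0 < β) (hγ : 1 < γ) (hM : 1 ≤ M) :
    ∃ C : ℝ, 0 < C ∧ ∀ S : Sol μ R a b κ₁ κ₂ β γ T, S.Bounded M ε → ∀ t ∈ Icc (0 : ℝ) T,
      ∀ s ∈ Icc (0 : ℝ) t, ∀ x ∈ Icc (-(1 / 2) : ℝ) (1 / 2),
        S.θ s x ^ (2 * β + 3) ≤ C * (1 + S.Y t) := by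
  obtain ⟨E, hE, hbd⟩ := exists_energy_bound μ R a b κ₁ κ₂ β γ T M ε hR hγ hM
  set p := β + 3 / 2 with hp
  refine ⟨2 * (E ^ p) ^ 2 + 2 * p ^ 2 * E / κ₂ ^ 2, by positivity, fun S hS t ht s hs x hx => ?_⟩
  have h1 := sq_rpow_le (S.sθ.hasDerivAt_px s) (S.sθ.px.continuous_px s) (S.θ_pos s)
    (hbd S hS s ⟨hs.1, hs.2.trans ht.2⟩).1 (by positivity : 0 < p) hx
  have h2 : (tInt fun z => S.θ s z ^ (2 * p - 3) * px S.θ s z ^ 2) ≤ 1 / κ₂ ^ 2 * S.Y t := by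
    refine le_trans ?_ (mul_le_mul_of_nonneg_left (S.tInt_le_Y hs) (by positivity))
    rw [← tInt_const_mul]
    refine tInt_mono (((S.sθ.rpow S.θ_pos _).mul (S.sθ.px.pow 2)).continuous_px s)
      (((((S.smooth_kappa.pow 2).mul (S.sθ.px.pow 2)).div (S.sv.pow 2)
        fun t x => pow_pos (S.v_pos t x) 2).continuous_px s).const_mul _) fun z _ => ?_
    have hv := S.v_pos s z
    have hθ := S.θ_pos s z
    have hr : S.θ s z ^ (2 * p - 3) = (S.θ s z ^ β) ^ 2 := by
      rw [← rpow_natCast, ← rpow_mul hθ.le]; congr 1; rw [hp]; push_cast; ring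
    have e : 1 / κ₂ ^ 2 * (kappa κ₁ κ₂ β (S.v s z) (S.θ s z) ^ 2 * px S.θ s z ^ 2 /
        S.v s z ^ 2) = S.θ s z ^ (2 * p - 3) * px S.θ s z ^ 2 +
        (κ₁ ^ 2 + 2 * κ₁ * κ₂ * S.v s z * S.θ s z ^ β) * px S.θ s z ^ 2 /
          (κ₂ ^ 2 * S.v s z ^ 2) := by
      rw [hr, kappa]; field_simp; ring
    rw [e]
    have : 0 < S.θ s z ^ β := rpow_pos_of_pos hθ _
    exact le_add_of_nonneg_right (by positivity)
  have e : (S.θ s x ^ p) ^ 2 = S.θ s x ^ (2 * β + 3) := by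
    rw [← rpow_natCast, ← rpow_mul (S.θ_pos s x).le]; congr 1; rw [hp]; push_cast; ring
  rw [e] at h1
  have h4 := mul_le_mul_of_nonneg_left h2 (by positivity : 0 ≤ 2 * p ^ 2 * E)
  have hY := S.Y_nonneg ht.1
  have h5 : 0 ≤ 2 * (E ^ p) ^ 2 * S.Y t + 2 * p ^ 2 * E / κ₂ ^ 2 := by positivity
  have h6 : 2 * p ^ 2 * E * (1 / κ₂ ^ 2 * S.Y t) = 2 * p ^ 2 * E / κ₂ ^ 2 * S.Y t := by ring
  linarith

end Sol

theorem abs_tInt_le {f : ℝ → ℝ} : |tInt f| ≤ tInt fun x => |f x| :=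
  intervalIntegral.abs_integral_le_integral_abs (by norm_num)

namespace Sol

variable {μ R a b κ₁ κ₂ β γ T M ε : ℝ} {S : Sol μ R a b κ₁ κ₂ β γ T}

/-- The space primitive of the mean-free part of the velocity. -/
def velPrim (S : Sol μ R a b κ₁ κ₂ β γ T) (t x : ℝ) : ℝ :=
  ∫ y in (-(1 / 2))..x, (S.u t y - tInt (S.u 0))

theorem continuous_velPrim (S : Sol μ R a b κ₁ κ₂ β γ T) :
    Continuous fun p : ℝ × ℝ => S.velPrim p.1 p.2 :=
  intervalIntegral.continuous_parametric_primitive_of_continuous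
    (f := fun t y => S.u t y - tInt (S.u 0)) (S.su.continuous.sub continuous_const)

theorem hasDerivAt_velPrim_space (S : Sol μ R a b κ₁ κ₂ β γ T) (t x : ℝ) :
    HasDerivAt (S.velPrim t) (S.u t x - tInt (S.u 0)) x :=
  (((S.su.continuous_px t).sub continuous_const).integral_hasStrictDerivAt _ x).hasDerivAt

theorem hasDerivAt_velPrim_time (S : Sol μ R a b κ₁ κ₂ β γ T) (t x : ℝ) :
    HasDerivAt (fun s => S.velPrim s x) (∫ y in (-(1 / 2))..x, pt S.u t y) t :=
  hasDerivAt_intervalIntegral (F := fun t y => S.u t y - tInt (S.u 0))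
    (fun t x => (S.su.hasDerivAt_pt t x).sub_const _) (S.su.continuous.sub continuous_const)
    S.su.pt.continuous _ _ t

theorem integral_pt_u (S : Sol μ R a b κ₁ κ₂ β γ T) {t : ℝ} (ht : t ∈ Icc 0 T) (x : ℝ) :
    ∫ y in (-(1 / 2))..x, pt S.u t y = S.stress t x - S.stress t (-(1 / 2)) :=
  intervalIntegral.integral_eq_sub_of_hasDerivAt
    (fun y _ => S.pt_u ht y ▸ S.smooth_stress.hasDerivAt_px t y)
    ((S.su.pt.continuous_px t).intervalIntegrable _ _)

theorem hasDerivAt_weighted_velPrim (S : Sol μ R a b κ₁ κ₂ β γ T) {t : ℝ} (ht : t ∈ Icc 0 T) :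
    HasDerivAt (fun s => tInt fun x => S.v s x * S.velPrim s x)
      (-((tInt fun x => S.u t x ^ 2) - tInt (S.u 0) ^ 2 + R * tInt (S.θ t))
        - S.stress t (-(1 / 2))) t := by
  have hP := S.continuous_velPrim
  have hPt : Continuous fun p : ℝ × ℝ => ∫ y in (-(1 / 2))..p.2, pt S.u p.1 y :=
    intervalIntegral.continuous_parametric_primitive_of_continuous (f := pt S.u)
      S.su.pt.continuous
  have h := hasDerivAt_tInt (F := fun s x => S.v s x * S.velPrim s x)
    (fun t x => (S.sv.hasDerivAt_pt t x).mul (S.hasDerivAt_velPrim_time t x))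
    (S.sv.continuous.mul hP) ((S.sv.pt.continuous.mul hP).add (S.sv.continuous.mul hPt)) t
  refine h.congr_deriv ?_
  set m := tInt (S.u 0) with hm
  have cu := S.su.continuous_px t
  have cux := S.su.px.continuous_px t
  have cv := S.sv.continuous_px t
  have cθ := S.sθ.continuous_px t
  have cP : Continuous (S.velPrim t) := hP.comp (continuous_const.prodMk continuous_id)
  have hz : tInt (fun x => px S.u t x * S.velPrim t x + S.u t x * (S.u t x - m)
      + μ * px S.u t x) = 0 := by
    refine tInt_deriv (g := fun x => S.u t x * S.velPrim t x + μ * S.u t x)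
      (fun x => ((S.su.hasDerivAt_px t x).mul (S.hasDerivAt_velPrim_space t x)).add
        ((S.su.hasDerivAt_px t x).const_mul μ)) (by fun_prop) ?_
    have e1 : S.velPrim t (-(1 / 2)) = 0 := intervalIntegral.integral_same
    have e2 : S.velPrim t (1 / 2) = 0 := by
      change tInt (fun y => S.u t y - m) = 0
      rw [tInt_sub cu continuous_const, tInt_const, S.tInt_u ht, hm, sub_self]
    rw [e1, e2, Periodic.half (S.periodic_u t)]
  have e : ∀ x, pt S.v t x * S.velPrim t x + S.v t x * ∫ y in (-(1 / 2))..x, pt S.u t y =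
      (px S.u t x * S.velPrim t x + S.u t x * (S.u t x - m) + μ * px S.u t x) -
      (S.u t x ^ 2 - m * S.u t x + R * S.θ t x + S.stress t (-(1 / 2)) * S.v t x) := fun x => by
    rw [S.integral_pt_u ht, S.pt_v ht]
    have hv := (S.v_pos t x).ne'
    have : S.v t x * S.stress t x = μ * px S.u t x - R * S.θ t x := by
      rw [stress, viscous, pressure]; field_simp
    linear_combination this
  rw [tInt_congr e, tInt_sub (by fun_prop) (by fun_prop), hz,
    tInt_add (by fun_prop) (by fun_prop), tInt_add (by fun_prop) (by fun_prop),
    tInt_sub (by fun_prop) (by fun_prop), tInt_const_mul, tInt_const_mul, tInt_const_mul]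
  change _ - (_ - m * tInt (S.u t) + R * tInt (S.θ t) + _ * tInt (S.v t)) = _
  rw [S.tInt_u ht, S.tInt_v ht]
  ring

/-- The stress has a uniformly bounded primitive in time. -/
theorem exists_stress_primitive (μ R a b κ₁ κ₂ β γ T M ε : ℝ) (hR : 0 < R) (hγ : 1 < γ)
    (hT : 0 < T) (hM : 1 ≤ M) :
    ∃ K : ℝ, 0 < K ∧ ∀ S : Sol μ R a b κ₁ κ₂ β γ T, S.Bounded M ε →
      ∃ Q : ℝ → ℝ → ℝ, ∀ t ∈ Icc (0 : ℝ) T, ∀ x ∈ Icc (-(1 / 2) : ℝ) (1 / 2),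
        HasDerivAt (fun s => Q s x) (S.stress t x) t ∧ |Q t x| ≤ K := by
  obtain ⟨E, hE, hbd⟩ := exists_energy_bound μ R a b κ₁ κ₂ β γ T M ε hR hγ hM
  set B := 1 + E with hB
  refine ⟨3 * B + (E + B ^ 2 + R * E) * T, by positivity, fun S hS => ?_⟩
  set m := tInt (S.u 0) with hm
  set G : ℝ → ℝ := fun s => tInt fun x => S.v s x * S.velPrim s x
  set e : ℝ → ℝ := fun s => (tInt fun x => S.u s x ^ 2) - m ^ 2 + R * tInt (S.θ s)
  have ce : Continuous e := ((continuous_tInt (S.su.pow 2).continuous).sub continuous_const).add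
    ((continuous_tInt S.sθ.continuous).const_mul R)
  have h0 : (0 : ℝ) ∈ Icc 0 T := ⟨le_rfl, hT.le⟩
  have habs : ∀ t ∈ Icc 0 T, tInt (fun x => |S.u t x|) ≤ B / 2 := fun t ht =>
    tInt_abs_le_of_sq (S.su.continuous_px t) (hbd S hS t ht).2
  have hmB : |m| ≤ B / 2 := abs_tInt_le.trans (habs 0 h0)
  have hP : ∀ t ∈ Icc 0 T, ∀ x ∈ Icc (-(1 / 2) : ℝ) (1 / 2), |S.velPrim t x| ≤ B := by
    intro t ht x hx
    have cu := S.su.continuous_px t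
    have hl : (-(1 / 2) : ℝ) ∈ Icc (-(1 / 2) : ℝ) (1 / 2) := ⟨le_rfl, by norm_num⟩
    have e1 : S.velPrim t (-(1 / 2)) = 0 := intervalIntegral.integral_same
    have h1 := sub_le_tInt_abs (S.hasDerivAt_velPrim_space t) (by fun_prop) hx hl
    have h2 := sub_le_tInt_abs (S.hasDerivAt_velPrim_space t) (by fun_prop) hl hx
    have h3 : tInt (fun z => |S.u t z - m|) ≤ B := by
      have : tInt (fun z => |S.u t z - m|) ≤ tInt fun z => |S.u t z| + |m| :=
        tInt_mono (by fun_prop) (by fun_prop) fun z _ => abs_sub _ _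
      rw [tInt_add (by fun_prop) (by fun_prop), tInt_const] at this
      linarith [habs t ht]
    rw [e1] at h1 h2
    rw [abs_le]; constructor <;> linarith
  have hG : ∀ t ∈ Icc 0 T, |G t| ≤ B := by
    intro t ht
    have cv := S.sv.continuous_px t
    have cP : Continuous (S.velPrim t) :=
      S.continuous_velPrim.comp (continuous_const.prodMk continuous_id)
    refine abs_tInt_le.trans ?_
    have : tInt (fun x => |S.v t x * S.velPrim t x|) ≤ tInt fun x => B * S.v t x :=
      tInt_mono (by fun_prop) (by fun_prop) fun x hx => by
        rw [abs_mul, abs_of_pos (S.v_pos t x), mul_comm]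
        exact mul_le_mul_of_nonneg_right (hP t ht x hx) (S.v_pos t x).le
    rw [tInt_const_mul] at this
    change _ ≤ B * tInt (S.v t) at this
    rwa [S.tInt_v ht, mul_one] at this
  refine ⟨fun t x => S.velPrim t x + (G 0 - G t - ∫ s in (0 : ℝ)..t, e s),
    fun t ht x hx => ⟨?_, ?_⟩⟩
  · have h1 := S.hasDerivAt_velPrim_time t x
    rw [S.integral_pt_u ht] at h1
    have h2 := S.hasDerivAt_weighted_velPrim ht
    have h3 := (ce.integral_hasStrictDerivAt 0 t).hasDerivAt
    refine (h1.add ((h2.const_sub (G 0)).sub h3)).congr_deriv ?_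
    simp only [e]; ring
  · have h1 : |∫ s in (0 : ℝ)..t, e s| ≤ (E + B ^ 2 + R * E) * T := by
      have := intervalIntegral.norm_integral_le_of_norm_le_const (f := e) (a := 0) (b := t)
        (C := E + B ^ 2 + R * E) fun s hs => ?_
      · rw [norm_eq_abs, sub_zero, abs_of_nonneg ht.1] at this
        exact this.trans (mul_le_mul_of_nonneg_left ht.2 (by positivity))
      · rw [uIoc_of_le ht.1] at hs
        obtain ⟨b1, b2⟩ := hbd S hS s ⟨hs.1.le, hs.2.trans ht.2⟩
        have n1 : 0 ≤ tInt (S.θ s) := tInt_nonneg fun x => (S.θ_pos s x).le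
        have n2 : 0 ≤ tInt fun x => S.u s x ^ 2 := tInt_nonneg fun x => sq_nonneg _
        have n3 : m ^ 2 ≤ B ^ 2 := by
          rw [← sq_abs]; exact pow_le_pow_left₀ (abs_nonneg _) (by linarith) 2
        have n4 := mul_le_mul_of_nonneg_left b1 hR.le
        have n5 : 0 ≤ R * tInt (S.θ s) := by positivity
        have n6 : 0 ≤ R * E := by positivity
        have n7 := sq_nonneg m
        rw [norm_eq_abs, abs_le]
        constructor <;> simp only [e] <;> linarith [sq_nonneg B]
    have g0 := abs_le.1 (hG 0 h0)
    have gt := abs_le.1 (hG t ht)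
    have hp := abs_le.1 (hP t ht x hx)
    have h1' := abs_le.1 h1
    rw [abs_le]
    constructor <;> linarith [g0.1, g0.2, gt.1, gt.2, hp.1, hp.2, h1'.1, h1'.2]

theorem continuousOn_of_hasDerivAt {f f' : ℝ → ℝ} {s : Set ℝ}
    (h : ∀ t ∈ s, HasDerivAt f (f' t) t) : ContinuousOn f s :=
  fun t ht => (h t ht).continuousAt.continuousWithinAt

/-- Uniform positive lower and upper bounds for the specific volume. -/
theorem exists_v_bounds (μ R a b κ₁ κ₂ β γ T M ε : ℝ) (hμ : 0 < μ) (hR : 0 < R) (ha : 0 < a)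
    (hb : 0 < b) (hκ₁ : 0 < κ₁) (hκ₂ : 0 < κ₂) (hβ : 0 < β) (hγ : 1 < γ) (hT : 0 < T)
    (hM : 1 ≤ M) (hε : 0 < ε) :
    ∃ c C : ℝ, 0 < c ∧ 0 < C ∧ ∀ S : Sol μ R a b κ₁ κ₂ β γ T, S.Bounded M ε →
      ∀ t ∈ Icc (0 : ℝ) T, ∀ x ∈ Icc (-(1 / 2) : ℝ) (1 / 2), c ≤ S.v t x ∧ S.v t x ≤ C := by
  obtain ⟨K, hK, hQ⟩ := exists_stress_primitive μ R a b κ₁ κ₂ β γ T M ε hR hγ hT hM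
  obtain ⟨D, hD, hdis⟩ := exists_dissip_bound μ R a b κ₁ κ₂ β γ T M ε hμ hR ha hb hγ hM hε
  obtain ⟨C, hC, hθ⟩ := exists_theta_le_dissip μ R a b κ₁ κ₂ β γ T M ε hR hκ₁ hκ₂ hβ hγ hM
  set V := 1 + (1 + M ^ 2) / 2 with hV
  set L := exp (K / μ) with hL
  have hL0 : 0 < L := exp_pos _
  refine ⟨L⁻¹ * (ε * L⁻¹), L * (V * L + R / μ * L * C * (T + D)), by positivity, by positivity,
    fun S hS t ht x hx => ?_⟩
  obtain ⟨Q, hQS⟩ := hQ S hS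
  have h0 : (0 : ℝ) ∈ Icc 0 T := ⟨le_rfl, hT.le⟩
  have hexp : ∀ s ∈ Icc 0 T, exp (-(Q s x) / μ) ≤ L ∧ L⁻¹ ≤ exp (-(Q s x) / μ) := fun s hs => by
    have := abs_le.1 (hQS s hs x hx).2
    rw [hL, ← exp_neg, exp_le_exp, exp_le_exp, ← neg_div]
    constructor <;> gcongr <;> linarith
  have hder : ∀ s ∈ Icc 0 t, HasDerivAt (fun s => S.v s x * exp (-(Q s x) / μ))
      (R / μ * S.θ s x * exp (-(Q s x) / μ)) s := fun s hs => by
    have hs' : s ∈ Icc 0 T := ⟨hs.1, hs.2.trans ht.2⟩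
    refine ((S.sv.hasDerivAt_pt s x).mul
      (((hQS s hs' x hx).1.neg.div_const μ).exp)).congr_deriv ?_
    have := (S.v_pos s x).ne'
    rw [S.pt_v hs', stress, viscous, pressure]
    simp only [Pi.neg_apply]
    field_simp
    ring
  have cθ : Continuous fun s => S.θ s x := S.sθ.continuous_comp continuous_id continuous_const
  have cQ : ContinuousOn (fun s => Q s x) (Icc 0 t) :=
    continuousOn_of_hasDerivAt fun s hs => (hQS s ⟨hs.1, hs.2.trans ht.2⟩ x hx).1
  have cder : ContinuousOn (fun s => R / μ * S.θ s x * exp (-(Q s x) / μ)) (Icc 0 t) :=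
    ((cθ.const_mul _).continuousOn).mul (cQ.neg.div_const μ).rexp
  have hup0 : S.v 0 x ≤ V := by
    obtain ⟨y, hy, hvy⟩ := exists_le_tInt (S.sv.continuous_px 0)
    have h1 := sub_le_tInt_abs (S.sv.hasDerivAt_px 0) (S.sv.px.continuous_px 0) hx hy
    have h2 := tInt_abs_le_of_sq (S.sv.px.continuous_px 0) (hS.l2sq_le hM).2.1
    rw [S.mean_v] at hvy
    linarith
  have hvt := S.v_pos t x
  obtain ⟨hu0, hl0⟩ := hexp 0 h0
  obtain ⟨hut, hlt⟩ := hexp t ht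
  constructor
  · have h1 := integral_le_sub (g := fun _ => 0) ht.1 hder cder continuousOn_const fun s hs => by
      have := S.θ_pos s x
      positivity
    simp only [intervalIntegral.integral_zero] at h1
    have h2 : ε * L⁻¹ ≤ S.v 0 x * exp (-(Q 0 x) / μ) :=
      mul_le_mul (hS.2.1 x) hl0 (by positivity) (S.v_pos 0 x).le
    have h3 : S.v t x * exp (-(Q t x) / μ) ≤ S.v t x * L := by gcongr
    rw [inv_mul_le_iff₀ hL0]
    linarith
  · have h1 := integral_le_sub (g := fun s => -(R / μ * L * C * (1 + S.dissip s))) ht.1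
      (fun s hs => (hder s hs).neg) cder.neg
      (((continuous_const.add S.continuous_dissip).const_mul _).neg.continuousOn) fun s hs => by
        have hs' : s ∈ Icc 0 T := ⟨hs.1, hs.2.trans ht.2⟩
        have h2 := hθ S hS s hs' x hx
        have h3 := (hexp s hs').1
        have := S.θ_pos s x
        have := S.dissip_nonneg hκ₁ hκ₂ s
        have h4 : R / μ * S.θ s x * exp (-(Q s x) / μ) ≤ R / μ * (C * (1 + S.dissip s)) * L := by
          gcongr
        linarith
    have cD := S.continuous_dissip
    rw [intervalIntegral.integral_neg, intervalIntegral.integral_const_mul,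
      intervalIntegral.integral_add (by simp) (cD.intervalIntegrable _ _),
      intervalIntegral.integral_const, smul_eq_mul, sub_zero, mul_one] at h1
    simp only [Pi.neg_apply] at h1
    have h2 : R / μ * L * C * (t + ∫ s in (0 : ℝ)..t, S.dissip s) ≤ R / μ * L * C * (T + D) := by
      have := hdis S hS t ht
      have := ht.2
      gcongr
    have h3 : S.v 0 x * exp (-(Q 0 x) / μ) ≤ V * L :=
      mul_le_mul hup0 hu0 (by positivity) (by positivity)
    have h4 : S.v t x * L⁻¹ ≤ S.v t x * exp (-(Q t x) / μ) := by gcongr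
    have h5 : S.v t x * L⁻¹ ≤ V * L + R / μ * L * C * (T + D) := by linarith
    rwa [← div_eq_mul_inv, div_le_iff₀ hL0, mul_comm] at h5

end Sol

namespace Sol

variable {μ R a b κ₁ κ₂ β γ T M ε : ℝ}

/-- The effective velocity `u - μ v_x / v`. -/
def effVel (S : Sol μ R a b κ₁ κ₂ β γ T) (t x : ℝ) : ℝ := S.u t x - μ * px S.v t x / S.v t x

theorem smooth_effVel (S : Sol μ R a b κ₁ κ₂ β γ T) : Smooth S.effVel :=
  S.su.sub (((Smooth.const μ).mul S.sv.px).div S.sv S.v_pos)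

theorem pt_effVel (S : Sol μ R a b κ₁ κ₂ β γ T) (hμ : 0 < μ) {t : ℝ} (ht : t ∈ Icc 0 T)
    (x : ℝ) : pt S.effVel t x = -(R * px S.θ t x / S.v t x) +
      R * S.θ t x / (μ * S.v t x) * (S.u t x - S.effVel t x) := by
  have hv := (S.v_pos t x).ne'
  have e1 : pt S.effVel t x = pt S.u t x -
      (μ * pt (px S.v) t x * S.v t x - μ * px S.v t x * pt S.v t x) / S.v t x ^ 2 :=
    ((S.su.hasDerivAt_pt t x).sub
      (((S.sv.px.hasDerivAt_pt t x).const_mul μ).div (S.sv.hasDerivAt_pt t x) hv)).deriv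
  have e2 : px S.stress t x =
      (μ * px (px S.u) t x * S.v t x - μ * px S.u t x * px S.v t x) / S.v t x ^ 2 -
      (R * px S.θ t x * S.v t x - R * S.θ t x * px S.v t x) / S.v t x ^ 2 :=
    ((((S.su.px.hasDerivAt_px t x).const_mul μ).div (S.sv.hasDerivAt_px t x) hv).sub
      (((S.sθ.hasDerivAt_px t x).const_mul R).div (S.sv.hasDerivAt_px t x) hv)).deriv
  have e3 : pt (px S.v) t x = px (px S.u) t x := by
    rw [S.sv.pt_px]
    have : pt S.v t = px S.u t := funext (S.pt_v ht)
    change deriv (pt S.v t) x = deriv (px S.u t) x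
    rw [this]
  rw [e1, e3, S.pt_v ht, S.pt_u ht, e2, effVel]
  field_simp
  ring

/-- The bound for `v_x` in terms of an upper bound for `v θ² / κ`. -/
theorem exists_l2sq_px_v_le (μ R a b κ₁ κ₂ β γ T M ε : ℝ) (hμ : 0 < μ) (hR : 0 < R)
    (ha : 0 < a) (hb : 0 < b) (hκ₁ : 0 < κ₁) (hκ₂ : 0 < κ₂) (hβ : 0 < β) (hγ : 1 < γ)
    (hT : 0 < T) (hM : 1 ≤ M) (hε : 0 < ε) :
    ∃ C : ℝ, 0 < C ∧ ∀ S : Sol μ R a b κ₁ κ₂ β γ T, S.Bounded M ε → ∀ t ∈ Icc (0 : ℝ) T,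
      ∀ Λ : ℝ, 0 ≤ Λ → (∀ s ∈ Icc 0 t, ∀ x ∈ Icc (-(1 / 2) : ℝ) (1 / 2),
        S.v s x * S.θ s x ^ 2 ≤ Λ * kappa κ₁ κ₂ β (S.v s x) (S.θ s x)) →
      L2sq (px S.v t) ≤ C * (1 + Λ) := by
  obtain ⟨E, hE, hbd⟩ := exists_energy_bound μ R a b κ₁ κ₂ β γ T M ε hR hγ hM
  obtain ⟨D, hD, hdis⟩ := exists_dissip_bound μ R a b κ₁ κ₂ β γ T M ε hμ hR ha hb hγ hM hε
  obtain ⟨C, hC, hθ⟩ := exists_theta_le_dissip μ R a b κ₁ κ₂ β γ T M ε hR hκ₁ hκ₂ hβ hγ hM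
  obtain ⟨c, V, hc, hV, hv⟩ :=
    exists_v_bounds μ R a b κ₁ κ₂ β γ T M ε hμ hR ha hb hκ₁ hκ₂ hβ hγ hT hM hε
  set W₀ := 2 * M ^ 2 + 2 * μ ^ 2 / ε ^ 2 * M ^ 2
  set A := R ^ 2 / c ^ 2 * D
  set B := R / (2 * (μ * c)) * C * E * (T + D)
  refine ⟨2 * V ^ 2 / μ ^ 2 * (E + exp T * (W₀ + A + B)), by positivity,
    fun S hS t ht Λ hΛ hκ => ?_⟩
  have cD := S.continuous_dissip
  have hw := S.smooth_effVel
  have hsub : ∀ s ∈ Icc 0 t, s ∈ Icc 0 T := fun s hs => ⟨hs.1, hs.2.trans ht.2⟩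
  set W : ℝ → ℝ := fun s => tInt fun x => S.effVel s x ^ 2
  have hW0 : W 0 ≤ W₀ := by
    obtain ⟨-, h1, h2, -⟩ := hS.l2sq_le hM
    have cu := S.su.continuous_px 0
    have cvx := S.sv.px.continuous_px 0
    have : W 0 ≤ tInt fun x => 2 * S.u 0 x ^ 2 + 2 * μ ^ 2 / ε ^ 2 * px S.v 0 x ^ 2 := by
      refine tInt_mono ((hw.pow 2).continuous_px 0) (by fun_prop) fun x _ => ?_
      have h3 : (μ * px S.v 0 x / S.v 0 x) ^ 2 ≤ μ ^ 2 / ε ^ 2 * px S.v 0 x ^ 2 := by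
        have := hS.2.1 x
        rw [div_pow, mul_pow, mul_div_right_comm]
        gcongr
      have h4 : S.effVel 0 x ^ 2 ≤ 2 * S.u 0 x ^ 2 + 2 * (μ * px S.v 0 x / S.v 0 x) ^ 2 := by
        rw [effVel]
        nlinarith [sq_nonneg (S.u 0 x + μ * px S.v 0 x / S.v 0 x)]
      have h5 : 2 * μ ^ 2 / ε ^ 2 * px S.v 0 x ^ 2 = 2 * (μ ^ 2 / ε ^ 2 * px S.v 0 x ^ 2) := by
        ring
      linarith
    rw [tInt_add (by fun_prop) (by fun_prop), tInt_const_mul, tInt_const_mul] at this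
    change W 0 ≤ 2 * L2sq (S.u 0) + 2 * μ ^ 2 / ε ^ 2 * L2sq (px S.v 0) at this
    refine this.trans ?_
    simp only [W₀]
    gcongr
  set g : ℝ → ℝ := fun s => R ^ 2 / c ^ 2 * Λ * S.dissip s +
    R / (2 * (μ * c)) * C * E * (1 + S.dissip s)
  have cg : Continuous g := by fun_prop
  set W' : ℝ → ℝ := fun s => tInt fun x => 2 * S.effVel s x * pt S.effVel s x
  have hsW' : Smooth fun s x => 2 * S.effVel s x * pt S.effVel s x :=
    ((Smooth.const 2).mul hw).mul hw.pt
  have cW' : Continuous W' := continuous_tInt hsW'.continuous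
  have cW : Continuous W := continuous_tInt (hw.pow 2).continuous
  have hW : ∀ s, HasDerivAt W (W' s) s := fun s =>
    hasDerivAt_tInt (F := fun s x => S.effVel s x ^ 2)
      (F' := fun s x => 2 * S.effVel s x * pt S.effVel s x)
      (fun t x => ((hw.hasDerivAt_pt t x).pow 2).congr_deriv (by push_cast; ring))
      (hw.pow 2).continuous hsW'.continuous s
  have hdiff : ∀ s ∈ Icc 0 t, W' s ≤ W s + g s := fun s hs => by
    have hs' := hsub s hs
    have cw := hw.continuous_px s
    have cu := S.su.continuous_px s
    have cd := S.smooth_dissip.continuous_px s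
    have hDs := S.dissip_nonneg hκ₁ hκ₂ s
    have h1 : W' s ≤ tInt fun x => (S.effVel s x ^ 2 + R ^ 2 / c ^ 2 * Λ *
        (kappa κ₁ κ₂ β (S.v s x) (S.θ s x) * px S.θ s x ^ 2 / (S.v s x * S.θ s x ^ 2))) +
        R / (2 * (μ * c)) * C * (1 + S.dissip s) * S.u s x ^ 2 := by
      refine tInt_mono (hsW'.continuous_px s) (by fun_prop) fun x hx => ?_
      have hvp := S.v_pos s x
      have hθp := S.θ_pos s x
      have hvc := (hv S hS s hs' x hx).1
      have i1 : (R * px S.θ s x / S.v s x) ^ 2 ≤ R ^ 2 / c ^ 2 * px S.θ s x ^ 2 := by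
        rw [div_pow, mul_pow, mul_div_right_comm]
        gcongr
      have i2 : px S.θ s x ^ 2 ≤ Λ * (kappa κ₁ κ₂ β (S.v s x) (S.θ s x) * px S.θ s x ^ 2 /
          (S.v s x * S.θ s x ^ 2)) := by
        have := mul_le_mul_of_nonneg_right (hκ s hs x hx) (sq_nonneg (px S.θ s x))
        rw [← mul_div_assoc, le_div_iff₀ (by positivity)]
        linarith
      have i3 : R * S.θ s x / (2 * (μ * S.v s x)) * S.u s x ^ 2 ≤
          R / (2 * (μ * c)) * C * (1 + S.dissip s) * S.u s x ^ 2 := by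
        have h2 := hθ S hS s hs' x hx
        have : R * S.θ s x / (2 * (μ * S.v s x)) ≤
            R * (C * (1 + S.dissip s)) / (2 * (μ * c)) := by gcongr
        refine (mul_le_mul_of_nonneg_right this (sq_nonneg _)).trans_eq ?_
        ring
      have i4 := mul_le_mul_of_nonneg_left i2 (by positivity : 0 ≤ R ^ 2 / c ^ 2)
      have i5 : 2 * S.effVel s x * pt S.effVel s x ≤ S.effVel s x ^ 2 +
          (R * px S.θ s x / S.v s x) ^ 2 + R * S.θ s x / (2 * (μ * S.v s x)) * S.u s x ^ 2 := by
        rw [S.pt_effVel hμ hs']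
        have e : R * S.θ s x / (μ * S.v s x) = 2 * (R * S.θ s x / (2 * (μ * S.v s x))) := by
          field_simp
        rw [e]
        set r := R * S.θ s x / (2 * (μ * S.v s x))
        have hr : 0 ≤ r := by positivity
        nlinarith [sq_nonneg (S.effVel s x + R * px S.θ s x / S.v s x),
          mul_nonneg hr (sq_nonneg (S.u s x - 2 * S.effVel s x))]
      rw [← mul_assoc] at i4
      linarith
    rw [tInt_add (by fun_prop) (by fun_prop), tInt_add (by fun_prop) (by fun_prop),
      tInt_const_mul, tInt_const_mul] at h1
    change _ ≤ W s + R ^ 2 / c ^ 2 * Λ * S.dissip s + _ at h1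
    have h2 := mul_le_mul_of_nonneg_left (hbd S hS s hs').2
      (by positivity : 0 ≤ R / (2 * (μ * c)) * C * (1 + S.dissip s))
    simp only [g]
    linarith
  have hWt : W t ≤ exp T * (W₀ + A * Λ + B) := by
    have cexp : Continuous fun s : ℝ => exp (-s) := by fun_prop
    have hder : ∀ s, HasDerivAt (fun s => -(exp (-s) * W s)) (exp (-s) * (W s - W' s)) s :=
      fun s => (((hasDerivAt_neg s).exp.mul (hW s)).neg).congr_deriv (by ring)
    have h1 := integral_le_sub (g := fun s => -g s) ht.1 (fun s _ => hder s)
      (by fun_prop) cg.neg.continuousOn fun s hs => by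
        have h2 := hdiff s hs
        have hg0 : 0 ≤ g s := by
          have := S.dissip_nonneg hκ₁ hκ₂ s
          positivity
        have h3 : exp (-s) ≤ 1 := exp_le_one_iff.2 (by linarith [hs.1])
        nlinarith [exp_pos (-s)]
    have h2 : ∫ s in (0 : ℝ)..t, g s ≤ A * Λ + B := by
      have hd := hdis S hS t ht
      simp only [g]
      rw [intervalIntegral.integral_add ((cD.const_mul _).intervalIntegrable _ _)
        ((by fun_prop : Continuous fun s => R / (2 * (μ * c)) * C * E *
          (1 + S.dissip s)).intervalIntegrable _ _),
        intervalIntegral.integral_const_mul, intervalIntegral.integral_const_mul,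
        intervalIntegral.integral_add (by simp) (cD.intervalIntegrable _ _),
        intervalIntegral.integral_const, smul_eq_mul, sub_zero, mul_one]
      have e : A * Λ + B = R ^ 2 / c ^ 2 * Λ * D + R / (2 * (μ * c)) * C * E * (T + D) := by
        simp only [A, B]; ring
      rw [e]
      have := ht.2
      gcongr
    rw [intervalIntegral.integral_neg] at h1
    simp only [neg_zero, exp_zero, one_mul] at h1
    have h3 : exp (-t) * W t ≤ W₀ + A * Λ + B := by linarith
    rw [exp_neg, inv_mul_le_iff₀ (exp_pos t)] at h3
    refine h3.trans (mul_le_mul_of_nonneg_right (exp_le_exp.2 ht.2) (by positivity))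
  have cu := S.su.continuous_px t
  have cw := hw.continuous_px t
  have h1 : L2sq (px S.v t) ≤ 2 * V ^ 2 / μ ^ 2 * ((tInt fun x => S.u t x ^ 2) + W t) := by
    rw [← tInt_add (by fun_prop) (by fun_prop), ← tInt_const_mul]
    refine tInt_mono ((S.sv.px.pow 2).continuous_px t) (by fun_prop) fun x hx => ?_
    have hvp := S.v_pos t x
    have e : px S.v t x = S.v t x / μ * (S.u t x - S.effVel t x) := by
      rw [effVel]; field_simp; ring
    have h2 : (S.v t x) ^ 2 ≤ V ^ 2 := pow_le_pow_left₀ hvp.le (hv S hS t ht x hx).2 2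
    have h3 : (S.u t x - S.effVel t x) ^ 2 ≤ 2 * (S.u t x ^ 2 + S.effVel t x ^ 2) := by
      nlinarith [sq_nonneg (S.u t x + S.effVel t x)]
    calc px S.v t x ^ 2 = (S.v t x) ^ 2 / μ ^ 2 * (S.u t x - S.effVel t x) ^ 2 := by
          rw [e]; ring
      _ ≤ V ^ 2 / μ ^ 2 * (2 * (S.u t x ^ 2 + S.effVel t x ^ 2)) := by gcongr
      _ = _ := by ring
  refine h1.trans ?_
  have h2 := (hbd S hS t ht).2
  rw [mul_assoc]
  gcongr
  have h3 : exp T * (W₀ + A * Λ + B) ≤ exp T * (W₀ + A + B) * (1 + Λ) := by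
    rw [mul_assoc (exp T)]
    refine mul_le_mul_of_nonneg_left ?_ (exp_pos T).le
    have : 0 ≤ W₀ * Λ + A + B * Λ := by positivity
    linarith
  have : 0 ≤ E * Λ := by positivity
  linarith

end Sol

theorem two_div_le_T1 {n β : ℝ} (hn : 8 ≤ n) (hβ : 0 < β) (hβ' : β ≤ 5) :
    2 / (2 * β + 3) ≤ T1 n β := by
  refine le_trans ?_ (le_max_right _ _)
  rw [T0, if_neg (by linarith)]
  have h1 : 2 / (2 * β + 3) = 1 / (2 * β + 3) + n / (n * (2 * β + 3)) := by
    field_simp; ring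
  rw [h1]
  gcongr
  linarith

theorem T1_nonneg {n β : ℝ} (hn : 8 ≤ n) (hβ : 0 < β) : 0 ≤ T1 n β := by
  refine le_trans ?_ (le_max_right _ _)
  rw [T0]
  split_ifs with h
  · positivity
  · have e : 1 / (2 * β + 3) + (n - β + 5) / (n * (2 * β + 3)) =
        (2 * n - β + 5) / (n * (2 * β + 3)) := by field_simp; ring
    rw [e]
    exact div_nonneg (by linarith) (by positivity)

theorem sqrt_le_of_le_one_add_rpow {x C y r : ℝ} (hC : 0 < C) (hy : 0 ≤ y) (hr : 0 ≤ r)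
    (h : x ≤ C * (1 + y) ^ r) : √x ≤ √C * 2 ^ (r / 2) * (1 + y ^ (r / 2)) := by
  have h1 : √x ≤ √C * (1 + y) ^ (r / 2) := by
    refine (sqrt_le_sqrt h).trans_eq ?_
    rw [sqrt_mul hC.le, sqrt_eq_rpow ((1 + y) ^ r), ← rpow_mul (by linarith)]
    congr 2; ring
  refine h1.trans ?_
  rw [mul_assoc]
  gcongr
  have h2 : (1 + y) ^ (r / 2) ≤ (2 * max 1 y) ^ (r / 2) := by
    refine rpow_le_rpow (by linarith) ?_ (by linarith)
    linarith [le_max_left 1 y, le_max_right 1 y]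
  refine h2.trans ?_
  rw [mul_rpow (by norm_num) (by positivity)]
  gcongr
  have := rpow_nonneg hy (r / 2)
  rcases le_total 1 y with h | h
  · rw [max_eq_right h]; linarith
  · rw [max_eq_left h, one_rpow]; linarith

end RadHydro


theorem stmt_12 (μ R a b κ₁ κ₂ β γ : ℝ)
    (hμ : 0 < μ) (hR : 0 < R) (ha : 0 < a) (hb : 0 < b)
    (hκ₁ : 0 < κ₁) (hκ₂ : 0 < κ₂) (hβ : 0 < β) (hγ : 1 < γ)
    (T M ε : ℝ) (hT : 0 < T) (hM : 1 ≤ M) (hε0 : 0 < ε) (hε1 : ε ≤ 1)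
    (n : ℝ) (hn : 8 ≤ n) :
    ∃ C : ℝ, 0 < C ∧
      ∀ S : Sol μ R a b κ₁ κ₂ β γ T, S.Bounded M ε →
        ∀ t ∈ Icc (0 : ℝ) T,
          Real.sqrt (L2sq (px S.v t)) ≤ C * (1 + S.Y t ^ (T1 n β / 2)) := by
  obtain ⟨C, hC, hvx⟩ :=
    Sol.exists_l2sq_px_v_le μ R a b κ₁ κ₂ β γ T M ε hμ hR ha hb hκ₁ hκ₂ hβ hγ hT hM hε0
  obtain ⟨c, V, hc, hV, hv⟩ :=
    Sol.exists_v_bounds μ R a b κ₁ κ₂ β γ T M ε hμ hR ha hb hκ₁ hκ₂ hβ hγ hT hM hε0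
  obtain ⟨B, hB, hθY⟩ := Sol.exists_theta_le_Y μ R a b κ₁ κ₂ β γ T M ε hR hκ₁ hκ₂ hβ hγ hM
  suffices h : ∃ A : ℝ, 0 < A ∧ ∀ S : Sol μ R a b κ₁ κ₂ β γ T, S.Bounded M ε →
      ∀ t ∈ Icc (0 : ℝ) T, ∀ s ∈ Icc 0 t, ∀ x ∈ Icc (-(1 / 2) : ℝ) (1 / 2),
        S.v s x * S.θ s x ^ 2 ≤
          (A * (1 + S.Y t) ^ T1 n β) * kappa κ₁ κ₂ β (S.v s x) (S.θ s x) by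
    obtain ⟨A, hA, hΛ⟩ := h
    refine ⟨√(C * (1 + A)) * 2 ^ (T1 n β / 2), by positivity, fun S hS t ht => ?_⟩
    have hY := S.Y_nonneg ht.1
    have hone : 1 ≤ (1 + S.Y t) ^ T1 n β := one_le_rpow (by linarith) (T1_nonneg hn hβ)
    refine sqrt_le_of_le_one_add_rpow (by positivity) hY (T1_nonneg hn hβ) ?_
    refine (hvx S hS t ht _ (by positivity) (hΛ S hS t ht)).trans ?_
    rw [mul_assoc]
    gcongr
    linarith
  rcases le_total 2 β with h2 | h2
  · refine ⟨V / κ₁ + 1 / κ₂, by positivity, fun S hS t ht s hs x hx => ?_⟩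
    have hvp := S.v_pos s x
    have hθp := S.θ_pos s x
    have hY := S.Y_nonneg ht.1
    have hone : 1 ≤ (1 + S.Y t) ^ T1 n β := one_le_rpow (by linarith) (T1_nonneg hn hβ)
    have hk := kappa_pos (β := β) hκ₁ hκ₂ hvp hθp
    have hbeta : 0 < S.θ s x ^ β := rpow_pos_of_pos hθp _
    have h1 : S.v s x * S.θ s x ^ 2 ≤
        (V / κ₁ + 1 / κ₂) * kappa κ₁ κ₂ β (S.v s x) (S.θ s x) := by
      have e : (V / κ₁ + 1 / κ₂) * kappa κ₁ κ₂ β (S.v s x) (S.θ s x) =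
          V + S.v s x * S.θ s x ^ β + (V / κ₁ * (κ₂ * S.v s x * S.θ s x ^ β) + κ₁ / κ₂) := by
        rw [kappa]; field_simp; ring
      have e0 : 0 ≤ V / κ₁ * (κ₂ * S.v s x * S.θ s x ^ β) + κ₁ / κ₂ := by positivity
      rw [e]
      have hvV := (hv S hS s ⟨hs.1, hs.2.trans ht.2⟩ x hx).2
      rcases le_total (S.θ s x) 1 with h | h
      · have : S.θ s x ^ 2 ≤ 1 := pow_le_one₀ hθp.le h
        have : S.v s x * S.θ s x ^ 2 ≤ V * 1 := by gcongr
        have : 0 ≤ S.v s x * S.θ s x ^ β := by positivity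
        linarith
      · have := rpow_le_rpow_of_exponent_le h h2
        rw [rpow_two] at this
        have : S.v s x * S.θ s x ^ 2 ≤ S.v s x * S.θ s x ^ β := by gcongr
        linarith
    refine h1.trans (mul_le_mul_of_nonneg_right ?_ hk.le)
    exact le_mul_of_one_le_right (by positivity) hone
  · refine ⟨V / κ₁ * B ^ (2 / (2 * β + 3)), by positivity, fun S hS t ht s hs x hx => ?_⟩
    have hvp := S.v_pos s x
    have hθp := S.θ_pos s x
    have hY := S.Y_nonneg ht.1
    have hvV := (hv S hS s ⟨hs.1, hs.2.trans ht.2⟩ x hx).2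
    have h1 : S.θ s x ^ 2 ≤ B ^ (2 / (2 * β + 3)) * (1 + S.Y t) ^ T1 n β := by
      have h3 := rpow_le_rpow (rpow_pos_of_pos hθp _).le (hθY S hS t ht s hs x hx)
        (by positivity : 0 ≤ 2 / (2 * β + 3))
      rw [← rpow_mul hθp.le, mul_div_cancel₀ _ (by positivity), rpow_two,
        mul_rpow hB.le (by linarith)] at h3
      refine h3.trans ?_
      gcongr
      · linarith
      · exact two_div_le_T1 hn hβ (by linarith)
    have hk : κ₁ ≤ kappa κ₁ κ₂ β (S.v s x) (S.θ s x) := by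
      have : 0 < S.θ s x ^ β := rpow_pos_of_pos hθp _
      rw [kappa]
      exact le_add_of_nonneg_right (by positivity)
    calc S.v s x * S.θ s x ^ 2 ≤ V * (B ^ (2 / (2 * β + 3)) * (1 + S.Y t) ^ T1 n β) := by gcongr
      _ = (V / κ₁ * B ^ (2 / (2 * β + 3)) * (1 + S.Y t) ^ T1 n β) * κ₁ := by field_simp
      _ ≤ _ := by gcongr
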